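/- arXiv:1510.06580 — 9 statements merged into one kernel-verified Lean document; each statement's English description precedes it below -/
import Mathlib

section
/- For every polynomial p in W one has g*(h*(p)) = − h*(g*(g*(g*(p)))). In other words, on the degree-(1,1,1,1) part W of R the natural liftings satisfy g*h* = −h*(g*)^3, so g* and h* do not define a lifting of the group ⟨g,h⟩ (in which gh = hg^3) to H⁰(O(1,1,1,1)). -/
open MvPolynomial

noncomputable section

abbrev R : Type := MvPolynomial (Fin 4 × Fin 2) ℂ

/-- The variable `x_{i+1, j}` of the paper. -/
def x (i : Fin 4) (j : Fin 2) : R := MvPolynomial.X (i, j)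

/-- The algebra automorphism `g*`:
`g*(x_{1a}) = x_{2a}`, `g*(x_{2b}) = (-1)^b x_{1b}`,
`g*(x_{3c}) = x_{4c}`, `g*(x_{4d}) = (-1)^d x_{3d}`. -/
def gstar : R →ₐ[ℂ] R :=
  aeval fun p =>
    ![fun j => x 1 j,
      fun j => ((-1 : ℂ) ^ (j : ℕ)) • x 0 j,
      fun j => x 3 j,
      fun j => ((-1 : ℂ) ^ (j : ℕ)) • x 2 j] p.1 p.2

/-- The algebra automorphism `h*`:
`h*(x_{1a}) = x_{3,1-a}`, `h*(x_{2b}) = (-1)^{1-b} x_{4,1-b}`,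
`h*(x_{3c}) = x_{1c}`, `h*(x_{4d}) = (-1)^d x_{2d}`. -/
def hstar : R →ₐ[ℂ] R :=
  aeval fun p =>
    ![fun j => x 2 (j + 1),
      fun j => ((-1 : ℂ) ^ (1 - (j : ℕ))) • x 3 (j + 1),
      fun j => x 0 j,
      fun j => ((-1 : ℂ) ^ (j : ℕ)) • x 1 j] p.1 p.2

/-- `W`, the span of the 16 multidegree-(1,1,1,1) monomials,
a model for `H^0((ℙ¹)⁴, O(1,1,1,1))`. -/
def W : Submodule ℂ R :=
  Submodule.span ℂ {q | ∃ a b c d : Fin 2, q = x 0 a * x 1 b * x 2 c * x 3 d}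

@[simp] lemma gstar_x_zero (j : Fin 2) : gstar (x 0 j) = x 1 j := by
  simp [gstar, x]

@[simp] lemma gstar_x_one (j : Fin 2) : gstar (x 1 j) = ((-1 : ℂ) ^ (j : ℕ)) • x 0 j := by
  simp [gstar, x]

@[simp] lemma gstar_x_two (j : Fin 2) : gstar (x 2 j) = x 3 j := by
  simp [gstar, x]

@[simp] lemma gstar_x_three (j : Fin 2) : gstar (x 3 j) = ((-1 : ℂ) ^ (j : ℕ)) • x 2 j := by
  simp [gstar, x]

@[simp] lemma hstar_x_zero (j : Fin 2) : hstar (x 0 j) = x 2 (j + 1) := by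
  simp [hstar, x]

@[simp] lemma hstar_x_one (j : Fin 2) :
    hstar (x 1 j) = ((-1 : ℂ) ^ (1 - (j : ℕ))) • x 3 (j + 1) := by
  simp [hstar, x]

@[simp] lemma hstar_x_two (j : Fin 2) : hstar (x 2 j) = x 0 j := by
  simp [hstar, x]

@[simp] lemma hstar_x_three (j : Fin 2) : hstar (x 3 j) = ((-1 : ℂ) ^ (j : ℕ)) • x 1 j := by
  simp [hstar, x]

/-- On the variables of the first factor, `g* h*` and `h* (g*)³` differ by a sign. -/
lemma gstar_hstar_x_zero (j : Fin 2) :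
    gstar (hstar (x 0 j)) = -hstar (gstar (gstar (gstar (x 0 j)))) := by
  fin_cases j <;> simp

/-- On the variables of the other three factors, `g* h*` and `h* (g*)³` agree. -/
lemma gstar_hstar_x_of_ne_zero {i : Fin 4} (hi : i ≠ 0) (j : Fin 2) :
    gstar (hstar (x i j)) = hstar (gstar (gstar (gstar (x i j)))) := by
  fin_cases i <;> fin_cases j <;> simp at hi ⊢

/-- on `W` the natural liftings satisfy `g* h* = - h* (g*)³`. -/
theorem stmt_1 :
    ∀ p ∈ W, gstar (hstar p) = - hstar (gstar (gstar (gstar p))) := by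
  intro p hp
  induction hp using Submodule.span_induction with
  | mem q hq =>
    obtain ⟨a, b, c, d, rfl⟩ := hq
    simp only [map_mul, gstar_hstar_x_zero, gstar_hstar_x_of_ne_zero (i := 1) (by decide),
      gstar_hstar_x_of_ne_zero (i := 2) (by decide),
      gstar_hstar_x_of_ne_zero (i := 3) (by decide), neg_mul]
  | zero => simp
  | add p q _ _ hp hq => simp only [map_add, hp, hq, neg_add]
  | smul c p _ hp => simp only [map_smul, hp, smul_neg]
end
end

section
/- One has g*(F1) = −i·F1 and h*(F1) = −F1; moreover every p ∈ W satisfying g*(p) = −i·p and h*(p) = −p is a scalar multiple of F1. (Equivalently, for the lifting ρ1(g) = i·g*, ρ1(h) = −h*, the invariant subspace H⁰(O(1,1,1,1))^G is one-dimensional, generated by F1.) -/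
open MvPolynomial

noncomputable section

/-- `F1 = (x_{20}x_{30} - x_{21}x_{31})(x_{11}x_{40} + x_{10}x_{41})
        - i (x_{20}x_{31} - x_{21}x_{30})(x_{10}x_{40} + x_{11}x_{41})`. -/
def F1 : R :=
  (x 1 0 * x 2 0 - x 1 1 * x 2 1) * (x 0 1 * x 3 0 + x 0 0 * x 3 1) -
    C Complex.I * ((x 1 0 * x 2 1 - x 1 1 * x 2 0) * (x 0 0 * x 3 0 + x 0 1 * x 3 1))

/-- The point of `(ℂ²)⁴` whose four components are the standard basis vectors indexed by
`a`, `b`, `c`, `d`. -/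
def basisPoint (a b c d : Fin 2) (p : Fin 4 × Fin 2) : ℂ :=
  if p.2 = ![a, b, c, d] p.1 then 1 else 0

/-- Evaluation at `basisPoint a b c d`; on `W` it reads off the coefficient of
`x 0 a * x 1 b * x 2 c * x 3 d`. -/
def coord (a b c d : Fin 2) : R →ₗ[ℂ] ℂ :=
  (aeval (basisPoint a b c d)).toLinearMap

theorem coord_monomial (a b c d a' b' c' d' : Fin 2) :
    coord a b c d (x 0 a' * x 1 b' * x 2 c' * x 3 d') =
      if a' = a ∧ b' = b ∧ c' = c ∧ d' = d then 1 else 0 := by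
  simp only [coord, x, basisPoint, AlgHom.toLinearMap_apply, map_mul, aeval_X]
  by_cases ha : a' = a <;> by_cases hb : b' = b <;> by_cases hc : c' = c <;>
    by_cases hd : d' = d <;> simp [ha, hb, hc, hd]

theorem gstar_monomial (a b c d : Fin 2) :
    gstar (x 0 a * x 1 b * x 2 c * x 3 d) =
      ((-1 : ℂ) ^ ((b : ℕ) + d)) • (x 0 b * x 1 a * x 2 d * x 3 c) := by
  simp only [gstar, x, map_mul, aeval_X]
  simp only [Matrix.cons_val, smul_eq_C_mul, pow_add, map_mul]
  ring

theorem hstar_monomial (a b c d : Fin 2) :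
    hstar (x 0 a * x 1 b * x 2 c * x 3 d) =
      ((-1 : ℂ) ^ (1 - (b : ℕ) + d)) • (x 0 c * x 1 d * x 2 (a + 1) * x 3 (b + 1)) := by
  simp only [hstar, x, map_mul, aeval_X]
  simp only [Matrix.cons_val, smul_eq_C_mul, pow_add, map_mul]
  ring

theorem eq_sum_coord_of_mem_W {p : R} (hp : p ∈ W) :
    p = ∑ a, ∑ b, ∑ c, ∑ d, coord a b c d p • (x 0 a * x 1 b * x 2 c * x 3 d) := by
  induction hp using Submodule.span_induction with
  | mem p h =>
    obtain ⟨a, b, c, d, rfl⟩ := h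
    simp [coord_monomial, ite_and]
  | zero => simp
  | add p q _ _ hp hq =>
    simp only [map_add, add_smul, Finset.sum_add_distrib]
    rw [← hp, ← hq]
  | smul r p _ hp =>
    simp only [map_smul, smul_assoc, ← Finset.smul_sum]
    rw [← hp]

theorem coord_gstar {p : R} (hp : p ∈ W) (a b c d : Fin 2) :
    coord b a d c (gstar p) = (-1) ^ ((b : ℕ) + d) * coord a b c d p := by
  induction hp using Submodule.span_induction with
  | mem p h =>
    obtain ⟨a', b', c', d', rfl⟩ := h
    rw [gstar_monomial, map_smul, coord_monomial, coord_monomial, smul_eq_mul]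
    by_cases h : a' = a ∧ b' = b ∧ c' = c ∧ d' = d
    · obtain ⟨rfl, rfl, rfl, rfl⟩ := h
      simp
    · rw [if_neg h, if_neg (by tauto)]
      simp
  | zero => simp
  | add p q _ _ hp hq => simp only [map_add, hp, hq, mul_add]
  | smul r p _ hp => simp only [map_smul, hp, smul_eq_mul, mul_left_comm]

theorem coord_hstar {p : R} (hp : p ∈ W) (a b c d : Fin 2) :
    coord c d (a + 1) (b + 1) (hstar p) = (-1) ^ (1 - (b : ℕ) + d) * coord a b c d p := by
  induction hp using Submodule.span_induction with
  | mem p h =>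
    obtain ⟨a', b', c', d', rfl⟩ := h
    rw [hstar_monomial, map_smul, coord_monomial, coord_monomial, smul_eq_mul]
    by_cases h : a' = a ∧ b' = b ∧ c' = c ∧ d' = d
    · obtain ⟨rfl, rfl, rfl, rfl⟩ := h
      simp
    · rw [if_neg h, if_neg (by simp only [add_left_inj]; tauto)]
      simp
  | zero => simp
  | add p q _ _ hp hq => simp only [map_add, hp, hq, mul_add]
  | smul r p _ hp => simp only [map_smul, hp, smul_eq_mul, mul_left_comm]

theorem C_I_mul_C_I : (C Complex.I * C Complex.I : R) = -1 := by
  rw [← C_mul, Complex.I_mul_I, C_neg, C_1]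

theorem gstar_F1 : gstar F1 = (-Complex.I) • F1 := by
  have hI := C_I_mul_C_I
  simp only [F1, gstar, x, map_mul, map_sub, map_add, aeval_X, aeval_C, algebraMap_eq,
    Matrix.cons_val, smul_eq_C_mul, C_neg, Fin.val_zero, Fin.val_one, pow_zero, pow_one, C_1]
  linear_combination (-((X (1, 0) * X (2, 1) - X (1, 1) * X (2, 0)) *
    (X (0, 0) * X (3, 0) + X (0, 1) * X (3, 1))) : R) * hI

theorem hstar_F1 : hstar F1 = -F1 := by
  simp only [F1, hstar, x, map_mul, map_sub, map_add, aeval_X, aeval_C, algebraMap_eq,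
    Matrix.cons_val, smul_eq_C_mul, C_neg, Fin.val_zero, Fin.val_one, pow_zero, pow_one, C_1,
    zero_add, Fin.isValue, Nat.sub_zero, Nat.sub_self, show (1 + 1 : Fin 2) = 0 from rfl]
  ring

/-- `g*(F1) = -i·F1`, `h*(F1) = -F1`, and every `p ∈ W` with
`g*(p) = -i·p` and `h*(p) = -p` is a scalar multiple of `F1`. -/
theorem stmt_3 :
    gstar F1 = (-Complex.I) • F1 ∧
    hstar F1 = -F1 ∧
    ∀ p ∈ W, gstar p = (-Complex.I) • p → hstar p = -p → ∃ c : ℂ, p = c • F1 := by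
  refine ⟨gstar_F1, hstar_F1, fun p hp hg hh => ⟨coord 1 0 0 0 p, ?_⟩⟩
  have G (a b c d : Fin 2) :
      -Complex.I * coord b a d c p = (-1) ^ ((b : ℕ) + d) * coord a b c d p := by
    rw [← coord_gstar hp, hg, map_smul, smul_eq_mul]
  have H (a b c d : Fin 2) :
      -coord c d (a + 1) (b + 1) p = (-1) ^ (1 - (b : ℕ) + d) * coord a b c d p := by
    rw [← coord_hstar hp, hh, map_neg]
  have even_eq_zero (a b c d : Fin 2) (h : Even ((a : ℕ) + c + (b + d))) :
      coord a b c d p = 0 := by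
    have h₁ := G a b c d
    have h₂ := G b a d c
    have h₃ : (-1 : ℂ) ^ ((a : ℕ) + c) * (-1) ^ ((b : ℕ) + d) = 1 := by
      rw [← pow_add, h.neg_one_pow]
    linear_combination Complex.I / 2 * h₂ - (-1) ^ ((a : ℕ) + c) / 2 * h₁ +
      coord a b c d p * (Complex.I_mul_I - h₃) / 2
  have h₀₀₀₁ := H 1 0 0 0
  have h₀₁₁₁ := H 0 0 0 1
  have h₁₁₁₀ := H 0 1 1 1
  have h₀₁₀₀ := G 1 0 0 0
  have h₀₀₁₀ := H 0 1 0 0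
  have h₁₀₁₁ := H 0 0 1 0
  have h₁₁₀₁ := H 1 0 1 1
  simp only [Fin.isValue, Fin.val_zero, Fin.val_one, zero_add, add_zero,
    show (1 + 1 : Fin 2) = 0 from rfl, Nat.sub_zero, Nat.sub_self, pow_zero, pow_one,
    Nat.reduceAdd, even_two.neg_one_pow, one_mul, neg_one_mul, neg_inj]
    at h₀₀₀₁ h₀₁₁₁ h₁₁₁₀ h₀₁₀₀ h₀₀₁₀ h₁₀₁₁ h₁₁₀₁
  replace h₀₁₀₀ : coord 0 1 0 0 p = Complex.I * coord 1 0 0 0 p := by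
    linear_combination Complex.I * h₀₁₀₀ + coord 0 1 0 0 p * Complex.I_mul_I
  rw [neg_eq_iff_eq_neg] at h₀₁₁₁ h₀₀₁₀ h₁₁₀₁
  conv_lhs => rw [eq_sum_coord_of_mem_W hp]
  simp only [Fin.sum_univ_two]
  rw [even_eq_zero 0 0 0 0 (by decide), even_eq_zero 0 0 1 1 (by decide),
    even_eq_zero 0 1 0 1 (by decide), even_eq_zero 0 1 1 0 (by decide),
    even_eq_zero 1 0 0 1 (by decide), even_eq_zero 1 0 1 0 (by decide),
    even_eq_zero 1 1 0 0 (by decide), even_eq_zero 1 1 1 1 (by decide),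
    h₁₁₀₁, h₁₀₁₁, h₀₀₁₀, h₀₁₀₀, h₁₁₁₀, h₀₁₁₁, h₀₀₀₁]
  simp only [F1, smul_eq_C_mul, C_neg, C_mul, C_0]
  ring
end
end

section
/- One has g*(F2) = i·F2 and h*(F2) = −F2; moreover every p ∈ W satisfying g*(p) = i·p and h*(p) = −p is a scalar multiple of F2. (Equivalently, for the lifting ρ1(g) = i·g*, ρ1(h) = −h*, the subspace H⁰(O(1,1,1,1))^{−,+} of h-invariant vectors on which g acts as −1 is one-dimensional, generated by F2.) -/
open MvPolynomial

noncomputable section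

/-- `F2 = (x_{20}x_{30} - x_{21}x_{31})(x_{11}x_{40} + x_{10}x_{41})
        + i (x_{20}x_{31} - x_{21}x_{30})(x_{10}x_{40} + x_{11}x_{41})`. -/
def F2 : R :=
  (x 1 0 * x 2 0 - x 1 1 * x 2 1) * (x 0 1 * x 3 0 + x 0 0 * x 3 1) +
    C Complex.I * ((x 1 0 * x 2 1 - x 1 1 * x 2 0) * (x 0 0 * x 3 0 + x 0 1 * x 3 1))

/-- The point with `x_{i,j} = 1` when `j = e_i` and `x_{i,j} = 0` otherwise. -/
def vertex (a b c d : Fin 2) (p : Fin 4 × Fin 2) : ℂ :=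
  if p.2 = ![a, b, c, d] p.1 then 1 else 0

theorem eq_sum_eval_vertex {p : R} (hp : p ∈ W) :
    p = ∑ a, ∑ b, ∑ c, ∑ d, eval (vertex a b c d) p • (x 0 a * x 1 b * x 2 c * x 3 d) := by
  induction hp using Submodule.span_induction with
  | mem q hq =>
    obtain ⟨a, b, c, d, rfl⟩ := hq
    simp [x, vertex]
    fin_cases a <;> fin_cases b <;> fin_cases c <;> fin_cases d <;> simp
  | zero => simp
  | add p q _ _ hp hq =>
    conv_lhs => rw [hp, hq]
    simp only [map_add, add_smul, Finset.sum_add_distrib]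
  | smul r p _ hp =>
    conv_lhs => rw [hp]
    simp only [smul_eval, mul_smul, Finset.smul_sum]

theorem eval_vertex_gstar {p : R} (hp : p ∈ W) (a b c d : Fin 2) :
    eval (vertex b a d c) (gstar p) =
      (-1) ^ (b : ℕ) * (-1) ^ (d : ℕ) * eval (vertex a b c d) p := by
  induction hp using Submodule.span_induction with
  | mem q hq =>
    obtain ⟨a', b', c', d', rfl⟩ := hq
    simp only [x, gstar, vertex, map_mul, aeval_X, eval_X, smul_eval, Matrix.cons_val]
    by_cases ha : a' = a <;> by_cases hb : b' = b <;> by_cases hc : c' = c <;>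
      by_cases hd : d' = d <;> simp [ha, hb, hc, hd]
  | zero => simp
  | add p q _ _ hp hq => rw [map_add, map_add, hp, hq, map_add, mul_add]
  | smul r p _ hp => rw [map_smul, smul_eval, hp, smul_eval, mul_left_comm]

theorem eval_vertex_hstar {p : R} (hp : p ∈ W) (a b c d : Fin 2) :
    eval (vertex c d (a + 1) (b + 1)) (hstar p) =
      (-1) ^ (1 - (b : ℕ)) * (-1) ^ (d : ℕ) * eval (vertex a b c d) p := by
  induction hp using Submodule.span_induction with
  | mem q hq =>
    obtain ⟨a', b', c', d', rfl⟩ := hq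
    simp only [x, hstar, vertex, map_mul, aeval_X, eval_X, smul_eval, Matrix.cons_val,
      add_left_inj]
    by_cases ha : a' = a <;> by_cases hb : b' = b <;> by_cases hc : c' = c <;>
      by_cases hd : d' = d <;> simp [ha, hb, hc, hd]
  | zero => simp
  | add p q _ _ hp hq => rw [map_add, map_add, hp, hq, map_add, mul_add]
  | smul r p _ hp => rw [map_smul, smul_eval, hp, smul_eval, mul_left_comm]

theorem gstar_F2 : gstar F2 = Complex.I • F2 := by
  have hI : (C Complex.I : R) * C Complex.I = -1 := by
    rw [← C_mul, Complex.I_mul_I, C_neg, C_1]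
  simp [F2, gstar, x, smul_eq_C_mul]
  linear_combination (-(X (1, 0) * X (2, 1) - X (1, 1) * X (2, 0)) *
    (X (0, 0) * X (3, 0) + X (0, 1) * X (3, 1))) * hI

theorem hstar_F2 : hstar F2 = -F2 := by
  simp [F2, hstar, x]
  ring

theorem eq_smul_F2_of_eigenvector {p : R} (hp : p ∈ W) (hg : gstar p = Complex.I • p)
    (hh : hstar p = -p) : p = eval (vertex 1 0 0 0) p • F2 := by
  have hI := Complex.I_mul_I
  have G (a b c d : Fin 2) := eval_vertex_gstar hp a b c d
  have H (a b c d : Fin 2) := eval_vertex_hstar hp a b c d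
  simp only [hg, hh, smul_eval, map_neg] at G H
  have hsum := eq_sum_eval_vertex hp
  generalize hu : (fun a b c d => eval (vertex a b c d) p) = u at *
  have hu' (a b c d) : eval (vertex a b c d) p = u a b c d := by rw [← hu]
  simp only [hu'] at G H hsum ⊢
  have even (a b c d : Fin 2) (h : a + b + c + d = 0) : u a b c d = 0 := by
    have h₁ := G a b c d
    have h₂ := G b a d c
    fin_cases a <;> fin_cases b <;> fin_cases c <;> fin_cases d <;> simp at h h₁ h₂ ⊢ <;> grind
  have odd : u 0 1 0 0 = -Complex.I * u 1 0 0 0 ∧ u 0 0 1 0 = Complex.I * u 1 0 0 0 ∧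
      u 0 0 0 1 = u 1 0 0 0 ∧ u 0 1 1 1 = -u 1 0 0 0 ∧ u 1 0 1 1 = Complex.I * u 1 0 0 0 ∧
      u 1 1 0 1 = -Complex.I * u 1 0 0 0 ∧ u 1 1 1 0 = -u 1 0 0 0 := by
    have g₁ := G 0 1 0 0
    have g₂ := G 0 0 0 1
    have g₃ := G 0 1 1 1
    have g₄ := G 1 1 0 1
    have h₁ := H 1 0 0 0
    have h₂ := H 0 1 0 0
    have h₃ := H 0 0 1 0
    have h₄ := H 0 0 0 1
    have h₅ := H 0 1 1 1
    have h₆ := H 1 0 1 1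
    have h₇ := H 1 1 0 1
    have h₈ := H 1 1 1 0
    simp at g₁ g₂ g₃ g₄ h₁ h₂ h₃ h₄ h₅ h₆ h₇ h₈
    refine ⟨?_, ?_, ?_, ?_, ?_, ?_, ?_⟩ <;> grind
  obtain ⟨o₁, o₂, o₃, o₄, o₅, o₆, o₇⟩ := odd
  rw [hsum]
  simp [Fin.sum_univ_two, even, o₁, o₂, o₃, o₄, o₅, o₆, o₇, F2, smul_eq_C_mul]
  ring

/-- `g*(F2) = i·F2`, `h*(F2) = -F2`, and every `p ∈ W` with
`g*(p) = i·p` and `h*(p) = -p` is a scalar multiple of `F2`. -/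
theorem stmt_4 :
    gstar F2 = Complex.I • F2 ∧
    hstar F2 = -F2 ∧
    ∀ p ∈ W, gstar p = Complex.I • p → hstar p = -p → ∃ c : ℂ, p = c • F2 := by
  exact ⟨gstar_F2, hstar_F2, fun p hp hg hh => ⟨_, eq_smul_F2_of_eigenvector hp hg hh⟩⟩
end
end

section
/- For every j ∈ {0,1,2,3,4,5} one has g*(U_j) = U_j and h*(U_j) = U_j. (Equivalently, each U_j lies in the subspace H⁰(O(2,2,2,2))^{−,+} of elements u with ρ2(g)u = −u and ρ2(h)u = u, where ρ2 is the action induced on H⁰(O(2,2,2,2)) by the lifting ρ1(g) = i·g*, ρ1(h) = −h*.) -/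
open MvPolynomial

noncomputable section

def U0 : R :=
  x 1 0 * x 1 1 * x 2 0 * x 2 1 * (x 0 0 ^ 2 + x 0 1 ^ 2) * (x 3 0 ^ 2 + x 3 1 ^ 2) -
    x 0 0 * x 0 1 * x 3 0 * x 3 1 * (x 1 0 ^ 2 + x 1 1 ^ 2) * (x 2 0 ^ 2 + x 2 1 ^ 2)

def U1 : R :=
  x 0 0 * x 0 1 * x 2 0 * x 2 1 * (x 1 0 ^ 2 + x 1 1 ^ 2) * (x 3 0 ^ 2 + x 3 1 ^ 2) +
    x 1 0 * x 1 1 * x 3 0 * x 3 1 * (x 0 0 ^ 2 + x 0 1 ^ 2) * (x 2 0 ^ 2 + x 2 1 ^ 2)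

def U2 : R :=
  (x 0 0 ^ 2 * x 1 0 ^ 2 + x 0 1 ^ 2 * x 1 1 ^ 2) *
    (x 2 0 ^ 2 * x 3 0 ^ 2 + x 2 1 ^ 2 * x 3 1 ^ 2)

def U3 : R :=
  (x 0 1 ^ 2 * x 1 0 ^ 2 + x 0 0 ^ 2 * x 1 1 ^ 2) *
    (x 2 1 ^ 2 * x 3 0 ^ 2 + x 2 0 ^ 2 * x 3 1 ^ 2)

def U4 : R :=
  4 * (x 0 0 * x 0 1 * x 1 0 * x 1 1 * x 2 0 * x 2 1 * x 3 0 * x 3 1)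

def U5 : R :=
  U0 + C (1 / 2 : ℂ) * U2 + C (1 / 2 : ℂ) * U3 + U4 -
    C (1 / 2 : ℂ) *
      ((x 0 0 ^ 2 + x 0 1 ^ 2) * (x 1 0 ^ 2 + x 1 1 ^ 2) * (x 2 0 ^ 2 + x 2 1 ^ 2) *
        (x 3 0 ^ 2 + x 3 1 ^ 2))

theorem gstar_x (i : Fin 4) (j : Fin 2) :
    gstar (x i j) =
      ![fun j => x 1 j,
        fun j => ((-1 : ℂ) ^ (j : ℕ)) • x 0 j,
        fun j => x 3 j,
        fun j => ((-1 : ℂ) ^ (j : ℕ)) • x 2 j] i j := by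
  rw [gstar, x, aeval_X]

theorem hstar_x (i : Fin 4) (j : Fin 2) :
    hstar (x i j) =
      ![fun j => x 2 (j + 1),
        fun j => ((-1 : ℂ) ^ (1 - (j : ℕ))) • x 3 (j + 1),
        fun j => x 0 j,
        fun j => ((-1 : ℂ) ^ (j : ℕ)) • x 1 j] i j := by
  rw [hstar, x, aeval_X]

theorem algHom_four (f : R →ₐ[ℂ] R) : f 4 = 4 :=
  map_ofNat f 4

/-- each `U_j` is fixed by both `g*` and `h*`. -/
theorem stmt_5 :
    ∀ j : Fin 6,
      gstar (![U0, U1, U2, U3, U4, U5] j) = ![U0, U1, U2, U3, U4, U5] j ∧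
      hstar (![U0, U1, U2, U3, U4, U5] j) = ![U0, U1, U2, U3, U4, U5] j := by
  intro j
  fin_cases j <;> constructor <;>
    simp [U0, U1, U2, U3, U4, U5, gstar_x, hstar_x, algHom_four] <;> ring
end
end

section
/- There is no nonzero algebraic relation among U0,…,U5 of degree at most 9: if P ∈ ℂ[u0,u1,u2,u3,u4,u5] is homogeneous of degree n with 1 ≤ n ≤ 9 and the substitution P(U0,U1,U2,U3,U4,U5) is the zero polynomial of R, then P = 0. -/
open MvPolynomial

noncomputable section

/-- Every pair of complex numbers with `s² + c² = 1` has half-angle coordinates. -/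
theorem exists_half_angle {s c : ℂ} (h : s ^ 2 + c ^ 2 = 1) :
    ∃ a b : ℂ, a ^ 2 + b ^ 2 = 1 ∧ 2 * (a * b) = s ∧ a ^ 2 - b ^ 2 = c := by
  obtain ⟨z, hz⟩ := IsAlgClosed.exists_pow_nat_eq (c + Complex.I * s) two_pos
  have hI : Complex.I ^ 2 = -1 := Complex.I_sq
  have hz0 : z ≠ 0 := by
    rintro rfl
    have h1 : c + Complex.I * s = 0 := by rw [← hz]; ring
    have : (1 : ℂ) = 0 := by linear_combination (c - Complex.I * s) * h1 - h + s ^ 2 * hI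
    exact one_ne_zero this
  have hw : (z⁻¹) ^ 2 = c - Complex.I * s := by
    rw [inv_pow, hz]
    refine inv_eq_of_mul_eq_one_right ?_
    linear_combination h - s ^ 2 * hI
  have hzw : z * z⁻¹ = 1 := mul_inv_cancel₀ hz0
  refine ⟨(z + z⁻¹) / 2, -Complex.I * (z - z⁻¹) / 2, ?_, ?_, ?_⟩
  · linear_combination hzw + (z - z⁻¹) ^ 2 / 4 * hI
  · linear_combination -Complex.I / 2 * hz + Complex.I / 2 * hw - s * hI
  · linear_combination (hz + hw) / 2 - (z - z⁻¹) ^ 2 / 4 * hI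

/-- Square roots `cᵢ` of the `Aᵢ` can be signed so that `c₁c₂` and `c₃c₄` have prescribed sum and
product. -/
theorem exists_cosines {A₁ A₂ A₃ A₄ e f : ℂ} (hsum : A₁ * A₂ + A₃ * A₄ = e ^ 2 - 2 * f)
    (hprod : (A₁ * A₂) * (A₃ * A₄) = f ^ 2) :
    ∃ c₁ c₂ c₃ c₄ : ℂ, c₁ ^ 2 = A₁ ∧ c₂ ^ 2 = A₂ ∧ c₃ ^ 2 = A₃ ∧ c₄ ^ 2 = A₄ ∧
      c₁ * c₂ + c₃ * c₄ = e ∧ c₁ * c₂ * (c₃ * c₄) = f := by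
  obtain ⟨d₁, h₁⟩ := IsAlgClosed.exists_pow_nat_eq A₁ two_pos
  obtain ⟨c₂, h₂⟩ := IsAlgClosed.exists_pow_nat_eq A₂ two_pos
  obtain ⟨c₃, h₃⟩ := IsAlgClosed.exists_pow_nat_eq A₃ two_pos
  obtain ⟨c₄, h₄⟩ := IsAlgClosed.exists_pow_nat_eq A₄ two_pos
  obtain ⟨c₁, h₁, hf⟩ : ∃ c₁ : ℂ, c₁ ^ 2 = A₁ ∧ c₁ * c₂ * (c₃ * c₄) = f := by
    have : (d₁ * c₂ * (c₃ * c₄)) ^ 2 = f ^ 2 := by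
      rw [← hprod, ← h₁, ← h₂, ← h₃, ← h₄]; ring
    rcases sq_eq_sq_iff_eq_or_eq_neg.mp this with h | h
    · exact ⟨d₁, h₁, h⟩
    · exact ⟨-d₁, by rw [neg_sq, h₁], by linear_combination -h⟩
  have : (c₁ * c₂ + c₃ * c₄) ^ 2 = e ^ 2 := by
    rw [← h₁, ← h₂, ← h₃, ← h₄] at hsum
    linear_combination hsum + 2 * hf
  rcases sq_eq_sq_iff_eq_or_eq_neg.mp this with h | h
  · exact ⟨c₁, c₂, c₃, c₄, h₁, h₂, h₃, h₄, h, hf⟩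
  · exact ⟨-c₁, c₂, -c₃, c₄, by rw [neg_sq, h₁], h₂, by rw [neg_sq, h₃], h₄,
      by linear_combination -h, by linear_combination hf⟩

section Relation

variable {S : Type*} [CommRing S]

/-- A quadratic form whose vanishing is the degenerate locus of `relation`. -/
def relM (N e f p : S) : S := e ^ 2 - f ^ 2 + p ^ 2 - 2 * f * N - N ^ 2

/-- An auxiliary quadratic form in `relation`. -/
def relK (N e f : S) : S := e ^ 2 - 2 * f * N - 2 * N ^ 2

/-- An auxiliary quartic form in `relation`. -/
def relJ (N e f p q r : S) : S :=
  (q ^ 2 + r ^ 2) * relK N e f + q ^ 2 * r ^ 2 + 2 * p * N * (r ^ 2 - q ^ 2)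

/-- The part of the degree ten relation of degree less than ten in `N`. -/
def relationTail (N e f p q r : S) : S :=
  p ^ 2 * relJ N e f p q r ^ 2 +
    2 * p * N * relJ N e f p q r * relM N e f p * (relM N e f p + (q ^ 2 + r ^ 2)) -
    r ^ 2 * (q ^ 2 + 4 * p * N) * (relJ N e f p q r * relM N e f p +
      (relK N e f + 2 * p * N) * relM N e f p ^ 2)

/-- The homogeneous relation of degree ten, monic in `N`. -/
def relation (N e f p q r : S) : S :=
  (N * relM N e f p * (relM N e f p + (q ^ 2 + r ^ 2))) ^ 2 + relationTail N e f p q r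

end Relation

/-- On a nondegenerate zero of `relation`, the equations for the sines `sᵢ` can be solved. -/
theorem exists_sines {e f p q r : ℂ} (hp : p ≠ 0) (hM : relM 1 e f p ≠ 0)
    (h : relation 1 e f p q r = 0) :
    ∃ s₁ s₂ s₃ s₄ : ℂ, s₂ * s₃ - s₁ * s₄ = q ∧ s₁ * s₃ + s₂ * s₄ = r ∧ s₁ * s₂ * s₃ * s₄ = p ∧
      (1 - s₁ ^ 2) * (1 - s₂ ^ 2) + (1 - s₃ ^ 2) * (1 - s₄ ^ 2) = e ^ 2 - 2 * f ∧
      ((1 - s₁ ^ 2) * (1 - s₂ ^ 2)) * ((1 - s₃ ^ 2) * (1 - s₄ ^ 2)) = f ^ 2 := by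
  obtain ⟨d, hd⟩ := IsAlgClosed.exists_pow_nat_eq (q ^ 2 + 4 * p) two_pos
  obtain ⟨d', hd'⟩ := IsAlgClosed.exists_pow_nat_eq (r ^ 2 - 4 * p) two_pos
  set M := relM 1 e f p with hMdef
  set g := relJ 1 e f p q r / M with hg
  set g' := (M + (q ^ 2 + r ^ 2)) / p with hg'
  have hgM : M * g = relJ 1 e f p q r := by rw [hg]; field_simp
  have hgp : p * g' = M + (q ^ 2 + r ^ 2) := by rw [hg']; field_simp
  set k := g + relK 1 e f with hk
  obtain ⟨σ₀, hσ₀⟩ := IsAlgClosed.exists_pow_nat_eq (k + 2 * p) two_pos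
  obtain ⟨δ₀, hδ₀⟩ := IsAlgClosed.exists_pow_nat_eq (k - 2 * p) two_pos
  have hplus : (p * (g + g')) ^ 2 = r ^ 2 * (q ^ 2 + 4 * p) * (k + 2 * p) := by
    refine mul_left_cancel₀ (pow_ne_zero 2 hM) ?_
    rw [relation, relationTail, ← hMdef, ← hgM] at h
    rw [mul_add, hgp, hk]
    linear_combination h
  have hdiff : p * g * (p * g') = (q ^ 2 + r ^ 2) * (p * g) + (q ^ 2 + r ^ 2) * p * relK 1 e f +
      q ^ 2 * r ^ 2 * p + 2 * p ^ 2 * (r ^ 2 - q ^ 2) := by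
    rw [hgp, relJ] at *
    linear_combination p * hgM
  have hminus : (p * (g - g')) ^ 2 = q ^ 2 * (r ^ 2 - 4 * p) * (k - 2 * p) := by
    rw [hk] at hplus ⊢
    linear_combination hplus - 4 * hdiff
  obtain ⟨σ, hσ, hσg⟩ : ∃ σ : ℂ, σ ^ 2 = k + 2 * p ∧ r * d * σ = p * (g + g') := by
    have : (r * d * σ₀) ^ 2 = (p * (g + g')) ^ 2 := by
      rw [hplus, mul_pow, mul_pow, hd, hσ₀]
    rcases sq_eq_sq_iff_eq_or_eq_neg.mp this with h | h
    · exact ⟨σ₀, hσ₀, h⟩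
    · exact ⟨-σ₀, by rw [neg_sq, hσ₀], by linear_combination -h⟩
  obtain ⟨δ, hδ, hδg⟩ : ∃ δ : ℂ, δ ^ 2 = k - 2 * p ∧ q * d' * δ = p * (g' - g) := by
    have : (q * d' * δ₀) ^ 2 = (p * (g - g')) ^ 2 := by
      rw [hminus, mul_pow, mul_pow, hd', hδ₀]
    rcases sq_eq_sq_iff_eq_or_eq_neg.mp this with h | h
    · exact ⟨-δ₀, by rw [neg_sq, hδ₀], by linear_combination -h⟩
    · exact ⟨δ₀, hδ₀, by linear_combination h⟩
  obtain ⟨X, hX⟩ : ∃ X, X = (d + q) / 2 := ⟨_, rfl⟩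
  obtain ⟨Y, hY⟩ : ∃ Y, Y = (d - q) / 2 := ⟨_, rfl⟩
  obtain ⟨Z, hZ⟩ : ∃ Z, Z = (r + d') / 2 := ⟨_, rfl⟩
  obtain ⟨W, hW⟩ : ∃ W, W = (r - d') / 2 := ⟨_, rfl⟩
  obtain ⟨u, hu⟩ : ∃ u, u = (σ + δ) / 2 := ⟨_, rfl⟩
  obtain ⟨v, hv⟩ : ∃ v, v = (σ - δ) / 2 := ⟨_, rfl⟩
  have hXY : X * Y = p := by rw [hX, hY]; linear_combination hd / 4
  have hZW : Z * W = p := by rw [hZ, hW]; linear_combination -hd' / 4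
  have hq : X - Y = q := by rw [hX, hY]; ring
  have hr : Z + W = r := by rw [hZ, hW]; ring
  have huv : u * v = p := by rw [hu, hv]; linear_combination (hσ - hδ) / 4
  have huvk : u ^ 2 + v ^ 2 = k := by rw [hu, hv]; linear_combination (hσ + hδ) / 2
  have hgl : (Z * Y + X * W) * u + (X * Z + W * Y) * v = p * g := by
    rw [hX, hY, hZ, hW, hu, hv]; linear_combination (hσg - hδg) / 2
  have hgl' : (Z * Y + X * W) * v + (X * Z + W * Y) * u = p * g' := by
    rw [hX, hY, hZ, hW, hu, hv]; linear_combination (hσg + hδg) / 2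
  have hX0 : X ≠ 0 := by rintro rfl; exact hp (by rw [← hXY, zero_mul])
  have hZ0 : Z ≠ 0 := by rintro rfl; exact hp (by rw [← hZW, zero_mul])
  have hu0 : u ≠ 0 := by rintro rfl; exact hp (by rw [← huv, zero_mul])
  obtain ⟨s₁, hs₁⟩ := IsAlgClosed.exists_pow_nat_eq (u * Z / X) two_pos
  have hs0 : s₁ ≠ 0 := by
    rintro rfl
    have : u * Z / X ≠ 0 := by positivity
    exact this (by rw [← hs₁]; ring)
  have hs₁' : s₁ ^ 2 * X = u * Z := by rw [hs₁]; field_simp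
  have e23 : u / s₁ * (Z / s₁) = X := by field_simp; linear_combination -hs₁'
  have e24 : u / s₁ * (Y / s₁) = W := by
    field_simp
    refine mul_left_cancel₀ hX0 ?_
    linear_combination u * hXY - W * hs₁' - u * hZW
  have e12 : s₁ * (u / s₁) = u := by field_simp
  have e13 : s₁ * (Z / s₁) = Z := by field_simp
  have e14 : s₁ * (Y / s₁) = Y := by field_simp
  generalize u / s₁ = s₂ at *
  generalize Z / s₁ = s₃ at *
  generalize Y / s₁ = s₄ at *
  have e34 : s₃ * s₄ = v := by
    refine mul_left_cancel₀ hu0 ?_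
    linear_combination (-s₃ * s₄) * e12 + s₁ * s₄ * e23 + X * e14 + hXY - huv
  have huvs : s₁ * s₂ * s₃ * s₄ = p := by rw [← huv, ← e12, ← e34]; ring
  have hsq : s₁ ^ 2 + s₂ ^ 2 + s₃ ^ 2 + s₄ ^ 2 = g := by
    refine mul_left_cancel₀ hp ?_
    rw [← hgl, ← huvs, ← e12, ← e34, ← e13, ← e14, ← e23, ← e24]
    ring
  have hsum : (1 - s₁ ^ 2) * (1 - s₂ ^ 2) + (1 - s₃ ^ 2) * (1 - s₄ ^ 2) = e ^ 2 - 2 * f := by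
    rw [hk, relK, ← e12, ← e34] at huvk
    linear_combination huvk - hsq
  have hcross : (s₁ ^ 2 + s₂ ^ 2) * (s₃ * s₄) ^ 2 + (s₃ ^ 2 + s₄ ^ 2) * (s₁ * s₂) ^ 2 =
      M + (q ^ 2 + r ^ 2) := by
    rw [← hgp, ← hgl', ← e12, ← e34, ← e13, ← e14, ← e23, ← e24]
    ring
  refine ⟨s₁, s₂, s₃, s₄, by rw [e23, e14, hq], by rw [e13, e24, hr], huvs, hsum, ?_⟩
  rw [hMdef, relM, ← hq, ← hr, ← e13, ← e14, ← e23, ← e24, ← huvs] at hcross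
  linear_combination hsum - hcross

/-- The values `(U0, …, U5)`, up to scaling, in terms of the six coordinates of `relation`. -/
def coordVec {S : Type*} [CommRing S] (N e f p q r : S) : Fin 6 → S :=
  ![q, r, N + f + e, N + f - e, p, q + f + p - N]

theorem map_coordVec {S T : Type*} [CommRing S] [CommRing T] (φ : S →+* T) (N e f p q r : S)
    (j : Fin 6) : φ (coordVec N e f p q r j) =
      coordVec (φ N) (φ e) (φ f) (φ p) (φ q) (φ r) j := by
  fin_cases j <;> simp [coordVec]

theorem exists_eval_U_eq {e f p q r : ℂ} (hp : p ≠ 0) (hM : relM 1 e f p ≠ 0)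
    (h : relation 1 e f p q r = 0) :
    ∃ w : Fin 4 × Fin 2 → ℂ, ∀ j, eval w (![U0, U1, U2, U3, U4, U5] j) =
      1 / 4 * coordVec 1 e f p q r j := by
  obtain ⟨s₁, s₂, s₃, s₄, hq, hr, hs, hsum, hprod⟩ := exists_sines hp hM h
  obtain ⟨c₁, c₂, c₃, c₄, h₁, h₂, h₃, h₄, he, hf⟩ := exists_cosines hsum hprod
  obtain ⟨a₁, b₁, n₁, rfl, rfl⟩ := exists_half_angle (add_eq_of_eq_sub' h₁)
  obtain ⟨a₂, b₂, n₂, rfl, rfl⟩ := exists_half_angle (add_eq_of_eq_sub' h₂)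
  obtain ⟨a₃, b₃, n₃, rfl, rfl⟩ := exists_half_angle (add_eq_of_eq_sub' h₃)
  obtain ⟨a₄, b₄, n₄, rfl, rfl⟩ := exists_half_angle (add_eq_of_eq_sub' h₄)
  have hU0 : ∀ m₁ m₂ m₃ m₄ : ℂ, m₁ = 1 → m₂ = 1 → m₃ = 1 → m₄ = 1 →
      a₂ * b₂ * a₃ * b₃ * m₁ * m₄ - a₁ * b₁ * a₄ * b₄ * m₂ * m₃ = 1 / 4 * q := by
    rintro _ _ _ _ rfl rfl rfl rfl
    linear_combination hq / 4
  have hN : (a₁ ^ 2 + b₁ ^ 2) * (a₂ ^ 2 + b₂ ^ 2) = 1 := by rw [n₁, n₂, one_mul]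
  have hN' : (a₃ ^ 2 + b₃ ^ 2) * (a₄ ^ 2 + b₄ ^ 2) = 1 := by rw [n₃, n₄, one_mul]
  have hU2 : (a₁ ^ 2 * a₂ ^ 2 + b₁ ^ 2 * b₂ ^ 2) * (a₃ ^ 2 * a₄ ^ 2 + b₃ ^ 2 * b₄ ^ 2) =
      1 / 4 * (1 + f + e) := by
    have h : a₁ ^ 2 * a₂ ^ 2 + b₁ ^ 2 * b₂ ^ 2 =
        (1 + (a₁ ^ 2 - b₁ ^ 2) * (a₂ ^ 2 - b₂ ^ 2)) / 2 := by linear_combination hN / 2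
    have h' : a₃ ^ 2 * a₄ ^ 2 + b₃ ^ 2 * b₄ ^ 2 =
        (1 + (a₃ ^ 2 - b₃ ^ 2) * (a₄ ^ 2 - b₄ ^ 2)) / 2 := by linear_combination hN' / 2
    rw [h, h']
    linear_combination (he + hf) / 4
  have hU3 : (b₁ ^ 2 * a₂ ^ 2 + a₁ ^ 2 * b₂ ^ 2) * (b₃ ^ 2 * a₄ ^ 2 + a₃ ^ 2 * b₄ ^ 2) =
      1 / 4 * (1 + f - e) := by
    have h : b₁ ^ 2 * a₂ ^ 2 + a₁ ^ 2 * b₂ ^ 2 =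
        (1 - (a₁ ^ 2 - b₁ ^ 2) * (a₂ ^ 2 - b₂ ^ 2)) / 2 := by linear_combination hN / 2
    have h' : b₃ ^ 2 * a₄ ^ 2 + a₃ ^ 2 * b₄ ^ 2 =
        (1 - (a₃ ^ 2 - b₃ ^ 2) * (a₄ ^ 2 - b₄ ^ 2)) / 2 := by linear_combination hN' / 2
    rw [h, h']
    linear_combination (hf - he) / 4
  have hU4 : 4 * (a₁ * b₁ * a₂ * b₂ * a₃ * b₃ * a₄ * b₄) = 1 / 4 * p := by
    linear_combination hs / 4
  refine ⟨fun ij ↦ ![![a₁, b₁], ![a₂, b₂], ![a₃, b₃], ![a₄, b₄]] ij.1 ij.2, fun j ↦ ?_⟩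
  fin_cases j
  · simpa [U0, x, coordVec] using hU0 _ _ _ _ n₁ n₂ n₃ n₄
  · simp [U1, x, coordVec, n₁, n₂, n₃, n₄]
    linear_combination hr / 4
  · simpa [U2, x, coordVec] using hU2
  · simpa [U3, x, coordVec] using hU3
  · simpa [U4, x, coordVec] using hU4
  · simp [U5, U0, U2, U3, U4, x, coordVec, n₁, n₂, n₃, n₄]
    linear_combination hq / 4 + (hU2 + hU3) / 2 + hU4

theorem eval_mul_of_isHomogeneous {σ : Type*} [Fintype σ] {P : MvPolynomial σ ℂ} {n : ℕ}
    (hP : P.IsHomogeneous n) (c : ℂ) (v : σ → ℂ) :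
    eval (fun i ↦ c * v i) P = c ^ n * eval v P := by
  rw [eval_eq', eval_eq', Finset.mul_sum]
  refine Finset.sum_congr rfl fun d hd ↦ ?_
  have hn : ∑ i, d i = n := by
    rw [← hP (mem_support_iff.mp hd), Finsupp.weight_apply, Finsupp.sum_fintype] <;> simp
  rw [Finset.prod_congr rfl fun i _ ↦ mul_pow c (v i) (d i), Finset.prod_mul_distrib,
    Finset.prod_pow_eq_pow_sum, hn]
  ring

theorem eval_coordVec_eq_zero_of_relation {P : MvPolynomial (Fin 6) ℂ} {n : ℕ}
    (hP : P.IsHomogeneous n) (hU : aeval ![U0, U1, U2, U3, U4, U5] P = 0)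
    {N e f p q r : ℂ} (hN : N ≠ 0) (hp : p ≠ 0) (hM : relM N e f p ≠ 0)
    (h : relation N e f p q r = 0) : eval (coordVec N e f p q r) P = 0 := by
  have scale : ∀ a : ℂ, a = N * (a / N) := fun a ↦ by field_simp
  have hM' : relM 1 (e / N) (f / N) (p / N) ≠ 0 := by
    intro h0
    refine hM ?_
    have : relM N e f p = N ^ 2 * relM 1 (e / N) (f / N) (p / N) := by
      simp only [relM]; field_simp
    rw [this, h0, mul_zero]
  have h' : relation 1 (e / N) (f / N) (p / N) (q / N) (r / N) = 0 := by
    have : relation N e f p q r =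
        N ^ 10 * relation 1 (e / N) (f / N) (p / N) (q / N) (r / N) := by
      have key : ∀ e f p q r : ℂ, relation N (N * e) (N * f) (N * p) (N * q) (N * r) =
          N ^ 10 * relation 1 e f p q r := by
        intro e f p q r
        simp only [relation, relationTail, relM, relJ, relK]; ring
      rw [← key, ← scale, ← scale, ← scale, ← scale, ← scale]
    rw [this] at h
    exact (mul_eq_zero.mp h).resolve_left (pow_ne_zero _ hN)
  obtain ⟨w, hw⟩ := exists_eval_U_eq (div_ne_zero hp hN) hM' h'
  have hv : coordVec N e f p q r =
      fun j ↦ (4 * N) * eval w (![U0, U1, U2, U3, U4, U5] j) := by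
    funext j
    rw [hw]
    fin_cases j <;> simp [coordVec] <;> field_simp
  have h0 : eval (fun j ↦ eval w (![U0, U1, U2, U3, U4, U5] j)) P = 0 := by
    have := congrArg (aeval (R := ℂ) w) hU
    rwa [comp_aeval_apply, map_zero] at this
  rw [hv, eval_mul_of_isHomogeneous hP, h0, mul_zero]

section Separability

variable {S T : Type*} [CommRing S] [CommRing T]

/-- `relation` as a polynomial in its first argument. -/
def relPoly (e f p q r : S) : Polynomial S :=
  relation Polynomial.X (Polynomial.C e) (Polynomial.C f) (Polynomial.C p) (Polynomial.C q)
    (Polynomial.C r)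

/-- Its coprimality with `relPoly` detects that all roots are simple, nonzero, and no roots of
`relM`. -/
def badPoly (e f p q r : S) : Polynomial S :=
  Polynomial.derivative (relPoly e f p q r) *
    relM Polynomial.X (Polynomial.C e) (Polynomial.C f) (Polynomial.C p) * Polynomial.X

theorem relPoly_map (φ : S →+* T) (e f p q r : S) :
    (relPoly e f p q r).map φ = relPoly (φ e) (φ f) (φ p) (φ q) (φ r) := by
  simp [relPoly, relation, relationTail, relJ, relK, relM]

theorem badPoly_map (φ : S →+* T) (e f p q r : S) :
    (badPoly e f p q r).map φ = badPoly (φ e) (φ f) (φ p) (φ q) (φ r) := by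
  rw [badPoly, Polynomial.map_mul, Polynomial.map_mul, ← Polynomial.derivative_map, relPoly_map]
  simp [badPoly, relM]

theorem exists_relPoly_eq_X_pow_add (e f p q r : S) :
    ∃ T : Polynomial S, T.natDegree ≤ 9 ∧ relPoly e f p q r = Polynomial.X ^ 10 + T := by
  have expand : ∀ X e f p s : Polynomial S,
      X * relM X e f p * (relM X e f p + s) = X ^ 5 +
        (4 * f * X ^ 4 + X ^ 3 * (4 * f ^ 2 - 2 * (e ^ 2 - f ^ 2 + p ^ 2) - s) -
          2 * f * X ^ 2 * (2 * (e ^ 2 - f ^ 2 + p ^ 2) + s) +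
          X * (e ^ 2 - f ^ 2 + p ^ 2) * (e ^ 2 - f ^ 2 + p ^ 2 + s)) := by
    intro X e f p s
    simp only [relM]; ring
  rw [relPoly, relation, expand, add_sq, ← pow_mul, add_assoc, add_assoc]
  refine ⟨_, ?_, rfl⟩
  simp only [relationTail, relJ, relK, relM]
  compute_degree

theorem relPoly_monic (e f p q r : S) : (relPoly e f p q r).Monic := by
  nontriviality S
  obtain ⟨T, hT, h⟩ := exists_relPoly_eq_X_pow_add e f p q r
  rw [h]
  exact Polynomial.monic_X_pow_add
    ((Polynomial.degree_le_of_natDegree_le hT).trans_lt (by norm_num))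

theorem natDegree_relPoly [Nontrivial S] (e f p q r : S) : (relPoly e f p q r).natDegree = 10 := by
  obtain ⟨T, hT, h⟩ := exists_relPoly_eq_X_pow_add e f p q r
  rw [h, Polynomial.natDegree_add_eq_left_of_natDegree_lt] <;> rw [Polynomial.natDegree_X_pow]
  omega

end Separability

theorem isCoprime_relPoly_badPoly :
    IsCoprime (relPoly (1 : ℂ) 0 1 1 1) (badPoly (1 : ℂ) 0 1 1 1) := by
  have h : relPoly (1 : ℂ) 0 1 1 1 = Polynomial.X ^ 10 - 12 * Polynomial.X ^ 8 +
      46 * Polynomial.X ^ 6 - 61 * Polynomial.X ^ 4 + 31 * Polynomial.X ^ 2 - 1 := by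
    simp only [relPoly, relation, relationTail, relJ, relK, relM, map_one, map_zero]
    ring
  have h' : Polynomial.derivative (relPoly (1 : ℂ) 0 1 1 1) = 10 * Polynomial.X ^ 9 -
      96 * Polynomial.X ^ 7 + 276 * Polynomial.X ^ 5 - 244 * Polynomial.X ^ 3 +
      62 * Polynomial.X := by
    rw [h]
    simp only [Polynomial.derivative_add, Polynomial.derivative_sub, Polynomial.derivative_mul,
      Polynomial.derivative_X_pow, Polynomial.derivative_ofNat, Polynomial.derivative_one,
      Polynomial.C_eq_natCast]
    push_cast
    ring
  have hscale : Polynomial.C (57628000⁻¹ : ℂ) * 57628000 = 1 := by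
    rw [← Polynomial.C_ofNat, ← Polynomial.C_mul]
    norm_num
  refine ⟨Polynomial.C (57628000⁻¹ : ℂ) * (
          4626570 * Polynomial.X ^ 10 - 54904422 * Polynomial.X ^ 8
          + 229992642 * Polynomial.X ^ 6 - 413759398 * Polynomial.X ^ 4
          + 302725044 * Polynomial.X ^ 2 - 57628000),
    Polynomial.C (57628000⁻¹ : ℂ) * (
          462657 * Polynomial.X ^ 8 - 5675505 * Polynomial.X ^ 6
          + 22678587 * Polynomial.X ^ 4 - 32636788 * Polynomial.X ^ 2 + 16848331), ?_⟩
  rw [badPoly, h', h]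
  simp only [relM, map_one, map_zero]
  linear_combination hscale

theorem eval_coordVec_eq_zero_of_isCoprime {P : MvPolynomial (Fin 6) ℂ} {n : ℕ} (hn : n ≤ 9)
    (hP : P.IsHomogeneous n) (hU : aeval ![U0, U1, U2, U3, U4, U5] P = 0)
    {e f p q r : ℂ} (hp : p ≠ 0) (h : IsCoprime (relPoly e f p q r) (badPoly e f p q r)) (N : ℂ) :
    eval (coordVec N e f p q r) P = 0 := by
  set Q : Polynomial ℂ := aeval (coordVec Polynomial.X (Polynomial.C e) (Polynomial.C f)
    (Polynomial.C p) (Polynomial.C q) (Polynomial.C r)) P with hQ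
  have hQeval : ∀ N, Q.eval N = eval (coordVec N e f p q r) P := by
    intro N
    have := comp_aeval_apply (R := ℂ) (coordVec Polynomial.X (Polynomial.C e) (Polynomial.C f)
      (Polynomial.C p) (Polynomial.C q) (Polynomial.C r)) (Polynomial.aeval N) P
    rw [← hQ, Polynomial.coe_aeval_eq_eval] at this
    rw [this, ← aeval_eq_eval]
    congr 2
    funext j
    rw [← Polynomial.coe_evalRingHom, map_coordVec]
    simp
  have hsep : (relPoly e f p q r).Separable := by
    rw [badPoly, mul_assoc] at h
    exact h.of_mul_right_left
  suffices Q = 0 by rw [← hQeval, this, Polynomial.eval_zero]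
  refine Polynomial.eq_zero_of_natDegree_lt_card_of_eval_eq_zero' Q
    (relPoly e f p q r).roots.toFinset (fun N hN ↦ ?_) ?_
  · have hroot : (relPoly e f p q r).eval N = 0 := by
      simpa [(relPoly_monic e f p q r).ne_zero] using hN
    have hbad : (badPoly e f p q r).eval N ≠ 0 := by
      obtain ⟨a, b, hab⟩ := h
      intro h0
      have := congrArg (Polynomial.eval N) hab
      simp [hroot, h0] at this
    rw [badPoly, Polynomial.eval_mul, Polynomial.eval_mul, Polynomial.eval_X] at hbad
    have hM := right_ne_zero_of_mul (left_ne_zero_of_mul hbad)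
    rw [hQeval]
    refine eval_coordVec_eq_zero_of_relation hP hU (right_ne_zero_of_mul hbad) hp ?_ ?_
    · simpa [relM] using hM
    · simpa [relPoly, relation, relationTail, relM, relK, relJ] using hroot
  · rw [Multiset.toFinset_card_of_nodup (Polynomial.nodup_roots hsep),
      ← (IsAlgClosed.splits _).natDegree_eq_card_roots, natDegree_relPoly]
    refine (aeval_natDegree_le (m := n) (n := 1) P hP.totalDegree_le _ fun j ↦ ?_).trans_lt
      (by omega)
    fin_cases j <;> simp only [coordVec] <;> simp <;> compute_degree

theorem exists_ne_zero_forall_isCoprime : ∃ d : MvPolynomial (Fin 5) ℂ, d ≠ 0 ∧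
    ∀ y : Fin 5 → ℂ, eval y d ≠ 0 → y 2 ≠ 0 ∧
      IsCoprime (relPoly (y 0) (y 1) (y 2) (y 3) (y 4)) (badPoly (y 0) (y 1) (y 2) (y 3) (y 4)) := by
  set F : Polynomial (MvPolynomial (Fin 5) ℂ) := relPoly (X 0) (X 1) (X 2) (X 3) (X 4) with hF
  set H : Polynomial (MvPolynomial (Fin 5) ℂ) := badPoly (X 0) (X 1) (X 2) (X 3) (X 4) with hH
  have hFmap : ∀ y : Fin 5 → ℂ, F.map (eval y) = relPoly (y 0) (y 1) (y 2) (y 3) (y 4) := by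
    intro y; rw [hF, relPoly_map]; simp
  have hHmap : ∀ y : Fin 5 → ℂ, H.map (eval y) = badPoly (y 0) (y 1) (y 2) (y 3) (y 4) := by
    intro y; rw [hH, badPoly_map]; simp
  have hres : Polynomial.resultant F H ≠ 0 := by
    intro h0
    have h1 := Polynomial.resultant_map_map F H F.natDegree H.natDegree (eval ![1, 0, 1, 1, 1])
    rw [h0, map_zero, hFmap, hHmap] at h1
    obtain ⟨k, hk⟩ := Nat.exists_eq_add_of_le
      ((Polynomial.natDegree_map_le (f := eval ![(1 : ℂ), 0, 1, 1, 1]) (p := H)))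
    rw [hHmap] at hk
    have hdeg : F.natDegree = 10 := natDegree_relPoly _ _ _ _ _
    rw [hk, Polynomial.resultant_add_right_deg _ _ _ _ _ le_rfl, hdeg,
      ← natDegree_relPoly (1 : ℂ) 0 1 1 1] at h1
    refine (mul_ne_zero (pow_ne_zero _ ?_)
      (Polynomial.resultant_ne_zero _ _ isCoprime_relPoly_badPoly)) h1
    exact Polynomial.leadingCoeff_ne_zero.mpr (relPoly_monic _ _ _ _ _).ne_zero
  refine ⟨Polynomial.resultant F H * X 2, mul_ne_zero hres (X_ne_zero _), fun y hy ↦ ?_⟩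
  rw [map_mul, eval_X] at hy
  refine ⟨right_ne_zero_of_mul hy, ?_⟩
  obtain ⟨a, b, -, -, hab⟩ := Polynomial.exists_mul_add_mul_eq_C_resultant F H le_rfl le_rfl
    (Or.inl (by rw [hF, natDegree_relPoly]; norm_num))
  have := congrArg (Polynomial.map (eval y)) hab
  rw [Polynomial.map_add, Polynomial.map_mul, Polynomial.map_mul, hFmap, hHmap,
    Polynomial.map_C] at this
  have hunit := (Polynomial.isUnit_C (x := eval y (F.resultant H))).mpr
    (left_ne_zero_of_mul hy).isUnit
  obtain ⟨c, hc⟩ := hunit.exists_left_inv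
  exact ⟨c * a.map (eval y), c * b.map (eval y), by rw [← hc, ← this]; ring⟩

/-- no nonzero algebraic relation of degree `1 ≤ n ≤ 9` among `U0,…,U5`. -/
theorem stmt_7 :
    ∀ (n : ℕ), 1 ≤ n → n ≤ 9 →
      ∀ P : MvPolynomial (Fin 6) ℂ, P.IsHomogeneous n →
        aeval ![U0, U1, U2, U3, U4, U5] P = 0 → P = 0 := by
  intro n _ hn P hP hU
  obtain ⟨d, hd, hgood⟩ := exists_ne_zero_forall_isCoprime
  have hvanish : ∀ (N : ℂ) (y : Fin 5 → ℂ),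
      eval (coordVec N (y 0) (y 1) (y 2) (y 3) (y 4)) P = 0 := by
    intro N
    set Q : MvPolynomial (Fin 5) ℂ := aeval (coordVec (C N) (X 0) (X 1) (X 2) (X 3) (X 4)) P
      with hQ
    have hQeval : ∀ y : Fin 5 → ℂ,
        eval y Q = eval (coordVec N (y 0) (y 1) (y 2) (y 3) (y 4)) P := by
      intro y
      have := comp_aeval_apply (R := ℂ) (coordVec (C N) (X 0) (X 1) (X 2) (X 3) (X 4))
        (aeval y) P
      rw [← hQ, aeval_eq_eval] at this
      rw [this, aeval_eq_eval]
      congr 2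
      funext j
      rw [map_coordVec]
      simp
    have hdQ : d * Q = 0 := by
      refine MvPolynomial.funext fun y ↦ ?_
      rw [map_mul, map_zero, hQeval]
      by_cases hy : eval y d = 0
      · rw [hy, zero_mul]
      · obtain ⟨hp, hcop⟩ := hgood y hy
        rw [eval_coordVec_eq_zero_of_isCoprime hn hP hU hp hcop, mul_zero]
    intro y
    rw [← hQeval, (mul_eq_zero.mp hdQ).resolve_left hd, map_zero]
  refine MvPolynomial.funext fun u ↦ ?_
  have := hvanish (((u 2 + u 3) / 2 - (u 5 - u 0 - u 4)) / 2)
    ![(u 2 - u 3) / 2, ((u 2 + u 3) / 2 + (u 5 - u 0 - u 4)) / 2, u 4, u 0, u 1]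
  rw [map_zero, ← this]
  congr 2
  funext j
  fin_cases j <;> simp [coordVec] <;> ring
end
end

section
/- There exists a nonzero homogeneous polynomial P ∈ ℂ[u0,u1,u2,u3,u4,u5] of degree 10 with P(U0,U1,U2,U3,U4,U5) = 0 in R; moreover this relation is unique up to scalar: if P1 and P2 are homogeneous of degree 10, both vanish under substitution of (U0,…,U5), and P1 ≠ 0, then there exists c ∈ ℂ with P2 = c·P1. (Hence the closure Σ4 of the image of the rational map defined by (U0:⋯:U5) is an irreducible hypersurface of degree 10 in ℙ⁵.) -/
open MvPolynomial

noncomputable section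

/-- The defining form of the decic hypersurface, in the coordinates
`(u0, u1, u2, u3, u4, 2 * (u0 + u4 - u5))`. -/
def decic {S : Type*} [CommRing S] (p q a b k v : S) : S :=
  4 * (a * b) * (2 * (p ^ 2 * q ^ 2) - k * (p ^ 2 - q ^ 2) * (a + b + v)) ^ 2
    - 2 * (2 * (p ^ 2 * q ^ 2) - k * (p ^ 2 - q ^ 2) * (a + b + v)) * ((a + b) * v + 4 * (a * b))
        * (a * b * (p ^ 2 + q ^ 2 - a * b - k ^ 2) + 4 * k ^ 2 * (a * b)
          + k ^ 2 * (p ^ 2 + q ^ 2 - a * b - k ^ 2))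
    + k ^ 2 * ((a + b) * v + 4 * (a * b)) ^ 2 * (p ^ 2 + q ^ 2) ^ 2
    + (a + b + v) ^ 2 * ((p ^ 2 + q ^ 2 - a * b - k ^ 2) ^ 2 - 4 * k ^ 2 * (a * b))
        * (a * b - k ^ 2) ^ 2

/-- The coefficient of `v ^ 2` in `decic p q a b k v`. -/
def decicLead {S : Type*} [CommRing S] (p q a b k : S) : S :=
  4 * (a * b) * k ^ 2 * (p ^ 2 - q ^ 2) ^ 2
    + 2 * k * (p ^ 2 - q ^ 2) * (a + b)
        * (a * b * (p ^ 2 + q ^ 2 - a * b - k ^ 2) + 4 * k ^ 2 * (a * b)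
          + k ^ 2 * (p ^ 2 + q ^ 2 - a * b - k ^ 2))
    + k ^ 2 * (a + b) ^ 2 * (p ^ 2 + q ^ 2) ^ 2
    + ((p ^ 2 + q ^ 2 - a * b - k ^ 2) ^ 2 - 4 * k ^ 2 * (a * b)) * (a * b - k ^ 2) ^ 2

/-- The coefficient of `v` in `decic p q a b k v`. -/
def decicMid {S : Type*} [CommRing S] (p q a b k : S) : S :=
  -(8 * (a * b) * k * (p ^ 2 - q ^ 2) * (2 * (p ^ 2 * q ^ 2) - k * (p ^ 2 - q ^ 2) * (a + b)))
    - 2 * (a * b * (p ^ 2 + q ^ 2 - a * b - k ^ 2) + 4 * k ^ 2 * (a * b)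
          + k ^ 2 * (p ^ 2 + q ^ 2 - a * b - k ^ 2))
        * ((a + b) * (2 * (p ^ 2 * q ^ 2) - k * (p ^ 2 - q ^ 2) * (a + b))
          - 4 * (a * b) * k * (p ^ 2 - q ^ 2))
    + 8 * k ^ 2 * (a * b) * (a + b) * (p ^ 2 + q ^ 2) ^ 2
    + 2 * (a + b) * ((p ^ 2 + q ^ 2 - a * b - k ^ 2) ^ 2 - 4 * k ^ 2 * (a * b))
        * (a * b - k ^ 2) ^ 2

theorem decic_eq_quadratic {S : Type*} [CommRing S] (p q a b k v : S) :
    decic p q a b k v =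
      decicLead p q a b k * v ^ 2 + decicMid p q a b k * v + decic p q a b k 0 := by
  simp only [decic, decicLead, decicMid]
  ring

theorem decic_smul {S : Type*} [CommRing S] (l p q a b k v : S) :
    decic (l * p) (l * q) (l * a) (l * b) (l * k) (l * v) = l ^ 10 * decic p q a b k v := by
  simp only [decic]
  ring

theorem map_decic {S T : Type*} [CommRing S] [CommRing T] (f : S →+* T) (p q a b k v : S) :
    f (decic p q a b k v) = decic (f p) (f q) (f a) (f b) (f k) (f v) := by
  simp only [decic, map_add, map_sub, map_mul, map_pow, map_ofNat]

theorem map_decicLead {S T : Type*} [CommRing S] [CommRing T] (f : S →+* T) (p q a b k : S) :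
    f (decicLead p q a b k) = decicLead (f p) (f q) (f a) (f b) (f k) := by
  simp only [decicLead, map_add, map_sub, map_mul, map_pow, map_ofNat]

theorem map_decicMid {S T : Type*} [CommRing S] [CommRing T] (f : S →+* T) (p q a b k : S) :
    f (decicMid p q a b k) = decicMid (f p) (f q) (f a) (f b) (f k) := by
  simp only [decicMid, map_add, map_sub, map_neg, map_mul, map_pow, map_ofNat]

theorem decic_eq_zero_of_symmetric {S : Type*} [CommRing S] {p q a b k v g g' s s' A B : S}
    (hk : k = 4 * (g * g')) (hab : a * b = A * B) (hT : a + b + v = s * s')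
    (hW : (a + b) * v + 4 * (a * b) = A * s' ^ 2 + B * s ^ 2)
    (hQ : p ^ 2 + q ^ 2 = (A + 4 * g ^ 2) * (B + 4 * g' ^ 2))
    (hK : 2 * (p ^ 2 * q ^ 2) - k * (p ^ 2 - q ^ 2) * (a + b + v) =
      2 * (g ^ 2 * (B + 4 * g' ^ 2) ^ 2 * s ^ 2 + g' ^ 2 * (A + 4 * g ^ 2) ^ 2 * s' ^ 2)) :
    decic p q a b k v = 0 := by
  simp only [decic]
  rw [hK, hW, hT, hab, hQ, hk]
  ring

theorem decic_U : decic U0 U1 U2 U3 U4 (2 * (U0 + U4 - U5)) = 0 := by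
  have hV : 2 * (U0 + U4 - U5) =
      (x 0 0 ^ 2 * x 1 0 ^ 2 + x 0 1 ^ 2 * x 1 1 ^ 2) *
          (x 2 1 ^ 2 * x 3 0 ^ 2 + x 2 0 ^ 2 * x 3 1 ^ 2) +
        (x 0 1 ^ 2 * x 1 0 ^ 2 + x 0 0 ^ 2 * x 1 1 ^ 2) *
          (x 2 0 ^ 2 * x 3 0 ^ 2 + x 2 1 ^ 2 * x 3 1 ^ 2) := by
    have h2 : (2 : R) * C (1 / 2 : ℂ) = 1 := by
      rw [← map_ofNat (C : ℂ →+* R) 2, ← map_mul]; norm_num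
    simp only [U5, U2, U3]
    linear_combination
      ((x 0 0 ^ 2 + x 0 1 ^ 2) * (x 1 0 ^ 2 + x 1 1 ^ 2) * (x 2 0 ^ 2 + x 2 1 ^ 2) *
        (x 3 0 ^ 2 + x 3 1 ^ 2) -
      (x 0 0 ^ 2 * x 1 0 ^ 2 + x 0 1 ^ 2 * x 1 1 ^ 2) *
        (x 2 0 ^ 2 * x 3 0 ^ 2 + x 2 1 ^ 2 * x 3 1 ^ 2) -
      (x 0 1 ^ 2 * x 1 0 ^ 2 + x 0 0 ^ 2 * x 1 1 ^ 2) *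
        (x 2 1 ^ 2 * x 3 0 ^ 2 + x 2 0 ^ 2 * x 3 1 ^ 2)) * h2
  have hT : U2 + U3 + 2 * (U0 + U4 - U5) =
      ((x 0 0 ^ 2 + x 0 1 ^ 2) * (x 1 0 ^ 2 + x 1 1 ^ 2)) *
        ((x 2 0 ^ 2 + x 2 1 ^ 2) * (x 3 0 ^ 2 + x 3 1 ^ 2)) := by
    rw [hV]; simp only [U2, U3]; ring
  refine decic_eq_zero_of_symmetric
    (g := x 0 0 * x 0 1 * (x 1 0 * x 1 1)) (g' := x 2 0 * x 2 1 * (x 3 0 * x 3 1))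
    (s := (x 0 0 ^ 2 + x 0 1 ^ 2) * (x 1 0 ^ 2 + x 1 1 ^ 2))
    (s' := (x 2 0 ^ 2 + x 2 1 ^ 2) * (x 3 0 ^ 2 + x 3 1 ^ 2))
    (A := (x 0 0 ^ 2 * x 1 0 ^ 2 + x 0 1 ^ 2 * x 1 1 ^ 2) *
      (x 0 1 ^ 2 * x 1 0 ^ 2 + x 0 0 ^ 2 * x 1 1 ^ 2))
    (B := (x 2 0 ^ 2 * x 3 0 ^ 2 + x 2 1 ^ 2 * x 3 1 ^ 2) *
      (x 2 1 ^ 2 * x 3 0 ^ 2 + x 2 0 ^ 2 * x 3 1 ^ 2)) ?_ ?_ hT ?_ ?_ ?_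
  · simp only [U4]; ring
  · simp only [U2, U3]; ring
  · rw [hV]; simp only [U2, U3]; ring
  · simp only [U0, U1]; ring
  · rw [hT]; simp only [U0, U1, U4]
    have h1 : (x 0 0 ^ 2 * x 1 0 ^ 2 + x 0 1 ^ 2 * x 1 1 ^ 2) *
        (x 0 1 ^ 2 * x 1 0 ^ 2 + x 0 0 ^ 2 * x 1 1 ^ 2) +
          4 * (x 0 0 * x 0 1 * (x 1 0 * x 1 1)) ^ 2 =
        (x 0 0 ^ 2 + x 0 1 ^ 2) ^ 2 * (x 1 0 * x 1 1) ^ 2 +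
          (x 1 0 ^ 2 + x 1 1 ^ 2) ^ 2 * (x 0 0 * x 0 1) ^ 2 := by ring
    have h2 : (x 2 0 ^ 2 * x 3 0 ^ 2 + x 2 1 ^ 2 * x 3 1 ^ 2) *
        (x 2 1 ^ 2 * x 3 0 ^ 2 + x 2 0 ^ 2 * x 3 1 ^ 2) +
          4 * (x 2 0 * x 2 1 * (x 3 0 * x 3 1)) ^ 2 =
        (x 2 0 ^ 2 + x 2 1 ^ 2) ^ 2 * (x 3 0 * x 3 1) ^ 2 +
          (x 3 0 ^ 2 + x 3 1 ^ 2) ^ 2 * (x 2 0 * x 2 1) ^ 2 := by ring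
    rw [h1, h2]
    generalize x 0 0 ^ 2 + x 0 1 ^ 2 = c₁
    generalize x 1 0 ^ 2 + x 1 1 ^ 2 = c₂
    generalize x 2 0 ^ 2 + x 2 1 ^ 2 = c₃
    generalize x 3 0 ^ 2 + x 3 1 ^ 2 = c₄
    ring

theorem exists_sq_add_inv_sq (c : ℂ) : ∃ t : ℂ, t ≠ 0 ∧ t ^ 2 + (t ^ 2)⁻¹ = c := by
  obtain ⟨d, hd⟩ := IsAlgClosed.exists_pow_nat_eq (c ^ 2 - 4) (n := 2) (by norm_num)
  obtain ⟨t, ht⟩ := IsAlgClosed.exists_pow_nat_eq ((c + d) / 2) (n := 2) (by norm_num)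
  have h : (c + d) * (c - d) = 4 := by linear_combination -hd
  have h0 : c + d ≠ 0 := by rintro h0; rw [h0] at h; norm_num at h
  have ht0 : t ≠ 0 := by
    rintro rfl
    exact h0 (by linear_combination -2 * ht)
  refine ⟨t, ht0, ?_⟩
  rw [ht]
  field_simp
  linear_combination hd

/-- The numbers `a` and `b` can be written as `s²t² + s⁻²t⁻²` and `s⁻²t² + s²t⁻²`,
where `s² + s⁻² = c₁` and `t² + t⁻² = c₂`. -/
theorem exists_torus_pair {c₁ c₂ a b : ℂ} (hadd : a + b = c₁ * c₂)
    (hmul : a * b = c₁ ^ 2 + c₂ ^ 2 - 4) :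
    ∃ s t : ℂ, s ≠ 0 ∧ t ≠ 0 ∧ s ^ 2 + s⁻¹ ^ 2 = c₁ ∧ t ^ 2 + t⁻¹ ^ 2 = c₂ ∧
      s ^ 2 * t ^ 2 + s⁻¹ ^ 2 * t⁻¹ ^ 2 = a ∧ s⁻¹ ^ 2 * t ^ 2 + s ^ 2 * t⁻¹ ^ 2 = b := by
  obtain ⟨s, hs, hs'⟩ := exists_sq_add_inv_sq c₁
  obtain ⟨t, ht, ht'⟩ := exists_sq_add_inv_sq c₂
  rw [← inv_pow] at hs' ht'
  have es : s ^ 2 * s⁻¹ ^ 2 = 1 := by field_simp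
  have et : t ^ 2 * t⁻¹ ^ 2 = 1 := by field_simp
  have key : (s ^ 2 * t ^ 2 + s⁻¹ ^ 2 * t⁻¹ ^ 2 - a) *
      (s⁻¹ ^ 2 * t ^ 2 + s ^ 2 * t⁻¹ ^ 2 - a) = 0 := by
    rw [← hs', ← ht'] at hadd hmul
    linear_combination (t ^ 4 + t⁻¹ ^ 4 - 2) * es + (s ^ 4 + s⁻¹ ^ 4 - 2) * et
      - hmul + a * hadd
  rcases mul_eq_zero.1 key with h | h
  · refine ⟨s, t, hs, ht, hs', ht', by linear_combination h, ?_⟩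
    rw [← hs', ← ht'] at hadd
    linear_combination -hadd - h
  · refine ⟨s, t⁻¹, hs, inv_ne_zero ht, hs', ?_, ?_, ?_⟩ <;> rw [inv_inv]
    · linear_combination ht'
    · linear_combination h
    · rw [← hs', ← ht'] at hadd
      linear_combination -hadd - h

theorem exists_paired_factors {A B s s' a b v : ℂ} (hab : a * b = A * B) (hT : a + b + v = s * s')
    (hW : (a + b) * v + 4 * (a * b) = B * s ^ 2 + A * s' ^ 2) :
    ∃ α β α' β' : ℂ, α + β = s ∧ α * β = A ∧ α' + β' = s' ∧ α' * β' = B ∧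
      α * α' = a ∧ β * β' = b := by
  have quad : ∀ s A : ℂ, ∃ α β : ℂ, α + β = s ∧ α * β = A := by
    intro s A
    obtain ⟨d, hd⟩ := IsAlgClosed.exists_pow_nat_eq (s ^ 2 - 4 * A) (n := 2) (by norm_num)
    exact ⟨(s + d) / 2, (s - d) / 2, by ring, by linear_combination -hd / 4⟩
  obtain ⟨α, β, rfl, rfl⟩ := quad s A
  obtain ⟨α', β', rfl, rfl⟩ := quad s' B
  obtain ⟨α', β', h1, h2, h3⟩ : ∃ γ δ : ℂ, γ + δ = α' + β' ∧ γ * δ = α' * β' ∧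
      α * γ + β * δ = a + b := by
    have : (α * α' + β * β' - (a + b)) * (α * β' + β * α' - (a + b)) = 0 := by
      linear_combination (a + b) * hT - hW + 4 * hab
    rcases mul_eq_zero.1 this with h | h
    · exact ⟨α', β', rfl, rfl, by linear_combination h⟩
    · exact ⟨β', α', by ring, by ring, by linear_combination h⟩
  rw [← h2] at hab ⊢
  rw [← h1]
  have : (α * α' - a) * (α * α' - b) = 0 := by
    linear_combination (α * α') * h3 + hab
  rcases mul_eq_zero.1 this with h | h
  · exact ⟨α, β, α', β', rfl, rfl, rfl, rfl, by linear_combination h,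
      by linear_combination h3 - h⟩
  · exact ⟨β, α, β', α', by ring, by ring, by ring, by ring, by linear_combination h3 - h,
      by linear_combination h⟩

/-- The system satisfied by `c₁, …, c₄` (with `A = c₁ ^ 2 + c₂ ^ 2 - 4`,
`B = c₃ ^ 2 + c₄ ^ 2 - 4`) is solvable at a general point of the decic. -/
theorem exists_cosines_s8 {p q a b v : ℂ} (hF : decic p q a b 4 v = 0) (hT : a + b + v ≠ 0)
    (hE : p ^ 2 - q ^ 2 + 4 * (a + b + v) ≠ 0) (hQ : p ^ 2 + q ^ 2 ≠ 0)
    (hS : (p ^ 2 + q ^ 2 - a * b - 4 ^ 2) ^ 2 - 4 * 4 ^ 2 * (a * b) ≠ 0)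
    (hN : a * b - 4 ^ 2 ≠ 0) :
    ∃ c₁ c₂ c₃ c₄ : ℂ, c₁ * c₄ - c₂ * c₃ = p ∧ c₂ * c₄ + c₁ * c₃ = q ∧
      a * b = (c₁ ^ 2 + c₂ ^ 2 - 4) * (c₃ ^ 2 + c₄ ^ 2 - 4) ∧
      a + b + v = (c₁ * c₂) * (c₃ * c₄) ∧
      (a + b) * v + 4 * (a * b) = (c₃ ^ 2 + c₄ ^ 2 - 4) * (c₁ * c₂) ^ 2 +
        (c₁ ^ 2 + c₂ ^ 2 - 4) * (c₃ * c₄) ^ 2 := by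
  obtain ⟨δ, hδ⟩ := IsAlgClosed.exists_pow_nat_eq
    ((p ^ 2 + q ^ 2 - a * b - 4 ^ 2) ^ 2 - 4 * 4 ^ 2 * (a * b)) (n := 2) (by norm_num)
  have hδ0 : δ ≠ 0 := by
    rintro rfl
    exact hS (by rw [← hδ]; norm_num)
  obtain ⟨A, hA⟩ : ∃ A, A = (p ^ 2 + q ^ 2 - a * b - 4 ^ 2 + δ) / 8 := ⟨_, rfl⟩
  obtain ⟨B, hB⟩ : ∃ B, B = (p ^ 2 + q ^ 2 - a * b - 4 ^ 2 - δ) / 8 := ⟨_, rfl⟩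
  have hAB : a * b = A * B := by rw [hA, hB]; linear_combination hδ / 64
  have hQAB : p ^ 2 + q ^ 2 = (A + 4) * (B + 4) := by
    linear_combination hAB - 4 * hA - 4 * hB
  have hsub : A - B ≠ 0 := by
    intro h
    exact hδ0 (by linear_combination 4 * h - 4 * hA + 4 * hB)
  have hA4 : A + 4 ≠ 0 := by
    intro h
    exact hQ (by rw [hQAB, h, zero_mul])
  rw [hAB] at hN
  obtain ⟨T, rfl⟩ : ∃ T, v = T - (a + b) := ⟨a + b + v, by ring⟩
  obtain ⟨W, hW⟩ : ∃ W, W = (a + b) * (T - (a + b)) + 4 * (a * b) := ⟨_, rfl⟩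
  obtain ⟨K, hK⟩ : ∃ K, K = p ^ 2 * q ^ 2 - 2 * (p ^ 2 - q ^ 2) * T := ⟨_, rfl⟩
  rw [show a + b + (T - (a + b)) = T by ring] at hT hE ⊢
  have hΔ : (A - B) * (A * B - 4 ^ 2) ≠ 0 := mul_ne_zero hsub hN
  obtain ⟨y, hy⟩ : ∃ y, y = (W * (A + 4) ^ 2 - A * K) / ((A - B) * (A * B - 4 ^ 2)) := ⟨_, rfl⟩
  obtain ⟨y', hy'⟩ : ∃ y', y' = (B * K - W * (B + 4) ^ 2) / ((A - B) * (A * B - 4 ^ 2)) :=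
    ⟨_, rfl⟩
  have ey : y * ((A - B) * (A * B - 4 ^ 2)) = W * (A + 4) ^ 2 - A * K := by
    rw [hy, div_mul_cancel₀ _ hΔ]
  have ey' : y' * ((A - B) * (A * B - 4 ^ 2)) = B * K - W * (B + 4) ^ 2 := by
    rw [hy', div_mul_cancel₀ _ hΔ]
  have hW' : B * y + A * y' = W := by
    apply mul_right_cancel₀ hΔ
    linear_combination B * ey + A * ey'
  have hK' : (B + 4) ^ 2 * y + (A + 4) ^ 2 * y' = K := by
    apply mul_right_cancel₀ hΔ
    linear_combination (B + 4) ^ 2 * ey + (A + 4) ^ 2 * ey'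
  have hyy : y * y' = T ^ 2 := by
    have : (W * (A + 4) ^ 2 - A * K) * (B * K - W * (B + 4) ^ 2) =
        T ^ 2 * ((A - B) * (A * B - 4 ^ 2)) ^ 2 := by
      have h : decic p q a b 4 (T - (a + b)) = 4 * (A * B) * (2 * K) ^ 2
          - 2 * (2 * K) * W * (A * B * (4 * (A + B)) + 4 * 4 ^ 2 * (A * B) + 4 ^ 2 * (4 * (A + B)))
          + 4 ^ 2 * W ^ 2 * ((A + 4) * (B + 4)) ^ 2
          + T ^ 2 * ((4 * (A + B)) ^ 2 - 4 * 4 ^ 2 * (A * B)) * (A * B - 4 ^ 2) ^ 2 := by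
        simp only [decic]
        rw [← hW, show a + b + (T - (a + b)) = T by ring, hQAB, hAB, hK]
        ring
      rw [h] at hF
      linear_combination -hF / 16
    rw [hy, hy', div_mul_div_comm, this]
    field_simp
  have hy0 : y ≠ 0 := by
    rintro h
    rw [h, zero_mul] at hyy
    exact hT (pow_eq_zero_iff two_ne_zero |>.1 hyy.symm)
  obtain ⟨s, hs⟩ := IsAlgClosed.exists_pow_nat_eq y (n := 2) (by norm_num)
  have hs0 : s ≠ 0 := by rintro rfl; exact hy0 (by rw [← hs]; norm_num)
  obtain ⟨s', hs'⟩ : ∃ s', s * s' = T := ⟨T / s, by field_simp⟩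
  have hs2 : s' ^ 2 = y' := by
    apply mul_left_cancel₀ hy0
    rw [hyy, ← hs, ← hs']; ring
  obtain ⟨D, D', hD, hDD, hsD⟩ : ∃ D D' : ℂ, D ^ 2 = (A + 4) ^ 2 - 4 * y ∧
      D * D' = p ^ 2 - q ^ 2 + 4 * T ∧ s * D' + s' * D = p * q := by
    obtain ⟨D, hD⟩ := IsAlgClosed.exists_pow_nat_eq ((A + 4) ^ 2 - 4 * y) (n := 2) (by norm_num)
    have hDE : D ^ 2 * ((B + 4) ^ 2 - 4 * y') = (p ^ 2 - q ^ 2 + 4 * T) ^ 2 := by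
      rw [hD]
      linear_combination 16 * hyy - 4 * hK' - 4 * hK - (p ^ 2 + q ^ 2 + (A + 4) * (B + 4)) * hQAB
    have hD0 : D ≠ 0 := by
      rintro rfl
      exact hE (pow_eq_zero_iff two_ne_zero |>.1 (by rw [← hDE]; ring))
    obtain ⟨D', hD'⟩ : ∃ D', D * D' = p ^ 2 - q ^ 2 + 4 * T :=
      ⟨(p ^ 2 - q ^ 2 + 4 * T) / D, by field_simp⟩
    have hD2 : D' ^ 2 = (B + 4) ^ 2 - 4 * y' := by
      apply mul_left_cancel₀ (pow_ne_zero 2 hD0)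
      rw [hDE, ← hD']; ring
    have : (s * D' + s' * D - p * q) * (s * D' + s' * D + p * q) = 0 := by
      linear_combination y * hD2 + y' * hD + 2 * D * D' * hs' + 2 * T * hD' + D' ^ 2 * hs
        + D ^ 2 * hs2 + hK' + hK - 8 * hyy
    rcases mul_eq_zero.1 this with h | h
    · exact ⟨D, D', hD, hD', by linear_combination h⟩
    · exact ⟨-D, -D', by rw [neg_sq, hD], by rw [neg_mul_neg, hD'], by linear_combination -h⟩
  obtain ⟨c₁, hc₁⟩ := IsAlgClosed.exists_pow_nat_eq ((A + 4 + D) / 2) (n := 2) (by norm_num)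
  have hc0 : c₁ ≠ 0 := by
    rintro rfl
    apply hy0
    have : A + 4 + D = 0 := by linear_combination -2 * hc₁
    linear_combination (A + 4 - D) / 4 * this + hD / 4
  obtain ⟨c₂, hc⟩ : ∃ c₂, c₁ * c₂ = s := ⟨s / c₁, by field_simp⟩
  have hc₂ : c₂ ^ 2 = (A + 4 - D) / 2 := by
    apply mul_left_cancel₀ (pow_ne_zero 2 hc0)
    rw [← mul_pow, hc, hc₁, hs]
    linear_combination hD / 4
  have hcA : c₁ ^ 2 + c₂ ^ 2 = A + 4 := by rw [hc₁, hc₂]; ring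
  obtain ⟨c₃, hc₃⟩ : ∃ c₃, c₃ = (q * c₁ - p * c₂) / (A + 4) := ⟨_, rfl⟩
  obtain ⟨c₄, hc₄⟩ : ∃ c₄, c₄ = (p * c₁ + q * c₂) / (A + 4) := ⟨_, rfl⟩
  have hcB : c₃ ^ 2 + c₄ ^ 2 = B + 4 := by
    rw [hc₃, hc₄]
    field_simp
    linear_combination (p ^ 2 + q ^ 2) * hcA + (A + 4) * hQAB
  have hc' : c₃ * c₄ = s' := by
    rw [hc₃, hc₄]
    field_simp
    linear_combination p * q * (hc₁ - hc₂) - (p ^ 2 - q ^ 2) * hc - D * hsD + s * hDD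
      - 4 * s * hs' + s' * (hD + 4 * hs)
  refine ⟨c₁, c₂, c₃, c₄, ?_, ?_, ?_, ?_, ?_⟩
  · rw [hc₃, hc₄]; field_simp; linear_combination p * hcA
  · rw [hc₃, hc₄]; field_simp; linear_combination q * hcA
  · rw [hcA, hcB, hAB]; ring
  · rw [hc, hc', hs']
  · rw [hcA, hcB, hc, hc', hs, hs2, ← hW, ← hW']; ring

/-- A general point of the decic is in the image of `(U0, …, U5)`. -/
theorem exists_eval_U_eq_s8 {p q a b k v : ℂ} (hF : decic p q a b k v = 0) (hk : k ≠ 0)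
    (hT : a + b + v ≠ 0) (hE : p ^ 2 - q ^ 2 + k * (a + b + v) ≠ 0) (hQ : p ^ 2 + q ^ 2 ≠ 0)
    (hS : (p ^ 2 + q ^ 2 - a * b - k ^ 2) ^ 2 - 4 * k ^ 2 * (a * b) ≠ 0)
    (hN : a * b - k ^ 2 ≠ 0) :
    ∃ y : Fin 4 × Fin 2 → ℂ, eval y U0 = p ∧ eval y U1 = q ∧ eval y U2 = a ∧ eval y U3 = b ∧
      eval y U4 = k ∧ eval y U5 = p + k - v / 2 := by
  obtain ⟨l, hl⟩ : ∃ l, l * k = 4 := ⟨4 / k, by field_simp⟩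
  have hl0 : l ≠ 0 := by rintro rfl; norm_num at hl
  obtain ⟨c₁, c₂, c₃, c₄, hp, hq, hab, hTc, hW⟩ :
      ∃ c₁ c₂ c₃ c₄ : ℂ, c₁ * c₄ - c₂ * c₃ = l * p ∧ c₂ * c₄ + c₁ * c₃ = l * q ∧
        (l * a) * (l * b) = (c₁ ^ 2 + c₂ ^ 2 - 4) * (c₃ ^ 2 + c₄ ^ 2 - 4) ∧
        l * a + l * b + l * v = (c₁ * c₂) * (c₃ * c₄) ∧
        (l * a + l * b) * (l * v) + 4 * ((l * a) * (l * b)) =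
          (c₃ ^ 2 + c₄ ^ 2 - 4) * (c₁ * c₂) ^ 2 + (c₁ ^ 2 + c₂ ^ 2 - 4) * (c₃ * c₄) ^ 2 := by
    apply exists_cosines_s8
    · rw [← hl, decic_smul, hF, mul_zero]
    · convert mul_ne_zero hl0 hT using 1; ring
    · convert mul_ne_zero (pow_ne_zero 2 hl0) hE using 1; rw [← hl]; ring
    · convert mul_ne_zero (pow_ne_zero 2 hl0) hQ using 1; ring
    · convert mul_ne_zero (pow_ne_zero 4 hl0) hS using 1; rw [← hl]; ring
    · convert mul_ne_zero (pow_ne_zero 2 hl0) hN using 1; rw [← hl]; ring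
  obtain ⟨α, β, α', β', h1, h2, h3, h4, h5, h6⟩ := exists_paired_factors hab hTc hW
  obtain ⟨t₁, t₂, ht₁, ht₂, e₁, e₂, e₁₂, e₁₂'⟩ := exists_torus_pair h1 h2
  obtain ⟨t₃, t₄, ht₃, ht₄, e₃, e₄, e₃₄, e₃₄'⟩ := exists_torus_pair h3 h4
  obtain ⟨m, hm⟩ := IsAlgClosed.exists_pow_nat_eq (k / 4) (n := 8) (by norm_num)
  have hml : m ^ 8 * l = 1 := by rw [hm]; linear_combination hl / 4
  have i₁ : t₁ * t₁⁻¹ = 1 := mul_inv_cancel₀ ht₁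
  have i₂ : t₂ * t₂⁻¹ = 1 := mul_inv_cancel₀ ht₂
  have i₃ : t₃ * t₃⁻¹ = 1 := mul_inv_cancel₀ ht₃
  have i₄ : t₄ * t₄⁻¹ = 1 := mul_inv_cancel₀ ht₄
  let y : Fin 4 × Fin 2 → ℂ := fun i =>
    m * ![![t₁, t₁⁻¹], ![t₂, t₂⁻¹], ![t₃, t₃⁻¹], ![t₄, t₄⁻¹]] i.1 i.2
  have y00 : eval y (x 0 0) = m * t₁ := by simp [x, y]
  have y01 : eval y (x 0 1) = m * t₁⁻¹ := by simp [x, y]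
  have y10 : eval y (x 1 0) = m * t₂ := by simp [x, y]
  have y11 : eval y (x 1 1) = m * t₂⁻¹ := by simp [x, y]
  have y20 : eval y (x 2 0) = m * t₃ := by simp [x, y]
  have y21 : eval y (x 2 1) = m * t₃⁻¹ := by simp [x, y]
  have y30 : eval y (x 3 0) = m * t₄ := by simp [x, y]
  have y31 : eval y (x 3 1) = m * t₄⁻¹ := by simp [x, y]
  have g0 : eval y U0 = p := by
    have : eval y U0 = m ^ 8 * ((t₂ * t₂⁻¹) * (t₃ * t₃⁻¹) *
        (t₁ ^ 2 + t₁⁻¹ ^ 2) * (t₄ ^ 2 + t₄⁻¹ ^ 2) - (t₁ * t₁⁻¹) * (t₄ * t₄⁻¹) *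
        (t₂ ^ 2 + t₂⁻¹ ^ 2) * (t₃ ^ 2 + t₃⁻¹ ^ 2)) := by
      simp only [U0, map_add, map_sub, map_mul, map_pow, y00, y01, y10, y11, y20, y21, y30, y31]
      ring
    rw [this, i₁, i₂, i₃, i₄, e₁, e₂, e₃, e₄]
    linear_combination m ^ 8 * hp + p * hml
  have g1 : eval y U1 = q := by
    have : eval y U1 = m ^ 8 * ((t₁ * t₁⁻¹) * (t₃ * t₃⁻¹) *
        (t₂ ^ 2 + t₂⁻¹ ^ 2) * (t₄ ^ 2 + t₄⁻¹ ^ 2) + (t₂ * t₂⁻¹) * (t₄ * t₄⁻¹) *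
        (t₁ ^ 2 + t₁⁻¹ ^ 2) * (t₃ ^ 2 + t₃⁻¹ ^ 2)) := by
      simp only [U1, map_add, map_mul, map_pow, y00, y01, y10, y11, y20, y21, y30, y31]
      ring
    rw [this, i₁, i₂, i₃, i₄, e₁, e₂, e₃, e₄]
    linear_combination m ^ 8 * hq + q * hml
  have g2 : eval y U2 = a := by
    have : eval y U2 = m ^ 8 * ((t₁ ^ 2 * t₂ ^ 2 + t₁⁻¹ ^ 2 * t₂⁻¹ ^ 2) *
        (t₃ ^ 2 * t₄ ^ 2 + t₃⁻¹ ^ 2 * t₄⁻¹ ^ 2)) := by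
      simp only [U2, map_add, map_mul, map_pow, y00, y01, y10, y11, y20, y21, y30, y31]
      ring
    rw [this, e₁₂, e₃₄]
    linear_combination m ^ 8 * h5 + a * hml
  have g3 : eval y U3 = b := by
    have : eval y U3 = m ^ 8 * ((t₁⁻¹ ^ 2 * t₂ ^ 2 + t₁ ^ 2 * t₂⁻¹ ^ 2) *
        (t₃⁻¹ ^ 2 * t₄ ^ 2 + t₃ ^ 2 * t₄⁻¹ ^ 2)) := by
      simp only [U3, map_add, map_mul, map_pow, y00, y01, y10, y11, y20, y21, y30, y31]
      ring
    rw [this, e₁₂', e₃₄']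
    linear_combination m ^ 8 * h6 + b * hml
  have g4 : eval y U4 = k := by
    have : eval y U4 = 4 * m ^ 8 * ((t₁ * t₁⁻¹) * (t₂ * t₂⁻¹) * (t₃ * t₃⁻¹) * (t₄ * t₄⁻¹)) := by
      simp only [U4, map_ofNat, map_mul, y00, y01, y10, y11, y20, y21, y30, y31]
      ring
    rw [this, i₁, i₂, i₃, i₄, hm]
    ring
  refine ⟨y, g0, g1, g2, g3, g4, ?_⟩
  have : eval y U5 = eval y U0 + 1 / 2 * eval y U2 + 1 / 2 * eval y U3 + eval y U4 -
      1 / 2 * (m ^ 8 * ((t₁ ^ 2 + t₁⁻¹ ^ 2) * (t₂ ^ 2 + t₂⁻¹ ^ 2) *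
        (t₃ ^ 2 + t₃⁻¹ ^ 2) * (t₄ ^ 2 + t₄⁻¹ ^ 2))) := by
    simp only [U5, map_add, map_sub, map_mul, map_pow, eval_C, y00, y01, y10, y11, y20, y21,
      y30, y31]
    ring
  rw [this, g0, g2, g3, g4, e₁, e₂, e₃, e₄]
  linear_combination m ^ 8 / 2 * hTc - (a + b + v) / 2 * hml

theorem exists_pow_mul_eq_quadratic_mul_add {A : Type*} [CommRing A] (α β γ : A)
    (g : Polynomial A) :
    ∃ (n : ℕ) (Q : Polynomial A) (r₁ r₀ : A), Polynomial.C α ^ n * g =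
      (Polynomial.C α * Polynomial.X ^ 2 + Polynomial.C β * Polynomial.X + Polynomial.C γ) * Q
        + (Polynomial.C r₁ * Polynomial.X + Polynomial.C r₀) := by
  induction g using Polynomial.induction_on with
  | C c => exact ⟨0, 0, 0, c, by simp⟩
  | add g h hg hh =>
    obtain ⟨n, Q, r₁, r₀, hg⟩ := hg
    obtain ⟨m, Q', r₁', r₀', hh⟩ := hh
    refine ⟨n + m, Polynomial.C α ^ m * Q + Polynomial.C α ^ n * Q', α ^ m * r₁ + α ^ n * r₁',
      α ^ m * r₀ + α ^ n * r₀', ?_⟩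
    simp only [map_add, map_mul, map_pow]
    linear_combination Polynomial.C α ^ m * hg + Polynomial.C α ^ n * hh
  | monomial n c h =>
    obtain ⟨m, Q, r₁, r₀, h⟩ := h
    refine ⟨m + 1, Polynomial.C α * Polynomial.X * Q + Polynomial.C r₁, α * r₀ - β * r₁,
      -(γ * r₁), ?_⟩
    simp only [map_sub, map_mul, map_neg]
    linear_combination Polynomial.C α * Polynomial.X * h

theorem isRelPrime_C_of_forall_dvd {A : Type*} [CommRing A] [IsDomain A] {α : A}
    {F : Polynomial A} (hα : α ≠ 0)
    (h : ∀ r, r ∣ α → Polynomial.C r ∣ F → IsUnit r) : IsRelPrime (Polynomial.C α) F := by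
  intro c hc hcF
  obtain ⟨r, rfl⟩ : ∃ r, c = Polynomial.C r := by
    refine ⟨_, Polynomial.eq_C_of_natDegree_le_zero ?_⟩
    simpa using Polynomial.natDegree_le_of_dvd hc (Polynomial.C_ne_zero.2 hα)
  refine Polynomial.isUnit_C.2 (h r ?_ hcF)
  simpa using (Polynomial.C_dvd_iff_dvd_coeff _ _).1 hc 0

theorem monic_decicLead {A : Type*} [CommRing A] (p q a b : A) :
    (decicLead (Polynomial.C p) (Polynomial.C q) (Polynomial.C a) (Polynomial.C b)
      Polynomial.X).Monic := by
  have h : ∀ c₀ c₁ c₂ c₃ c₄ c₅ c₆ : A, (Polynomial.X ^ 8 + Polynomial.C c₆ * Polynomial.X ^ 6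
      + Polynomial.C c₅ * Polynomial.X ^ 5 + Polynomial.C c₄ * Polynomial.X ^ 4
      + Polynomial.C c₃ * Polynomial.X ^ 3 + Polynomial.C c₂ * Polynomial.X ^ 2
      + Polynomial.C c₁ * Polynomial.X + Polynomial.C c₀).Monic := by
    intros
    monicity!
  obtain ⟨m, hm⟩ : ∃ m, m = p ^ 2 + q ^ 2 - a * b := ⟨_, rfl⟩
  obtain ⟨N, hN⟩ : ∃ N, N = a * b := ⟨_, rfl⟩
  convert h (m ^ 2 * N ^ 2) (2 * (p ^ 2 - q ^ 2) * (a + b) * (N * m))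
    (4 * N * (p ^ 2 - q ^ 2) ^ 2 + (a + b) ^ 2 * (p ^ 2 + q ^ 2) ^ 2
      - N ^ 2 * (2 * m + 4 * N) - 2 * N * m ^ 2)
    (2 * (p ^ 2 - q ^ 2) * (a + b) * (3 * N + m))
    (N ^ 2 + 2 * N * (2 * m + 4 * N) + m ^ 2)
    (-(2 * (p ^ 2 - q ^ 2) * (a + b))) (-(6 * N) - 2 * m) using 1
  simp only [decicLead, hm, hN, map_add, map_sub, map_neg, map_mul, map_pow, map_ofNat]
  ring

/-- The decic as a quadratic polynomial in `v` over `ℂ[k, p, q, a, b]`. -/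
def decicPoly : Polynomial (MvPolynomial (Fin 5) ℂ) :=
  decic (Polynomial.C (X 1)) (Polynomial.C (X 2)) (Polynomial.C (X 3)) (Polynomial.C (X 4))
    (Polynomial.C (X 0)) Polynomial.X

theorem isUnit_of_dvd_decicLead {r : MvPolynomial (Fin 5) ℂ}
    (hr : r ∣ decicLead (X 1) (X 2) (X 3) (X 4) (X 0)) (hr' : Polynomial.C r ∣ decicPoly) :
    IsUnit r := by
  have hv : r ∣ decic (X 1) (X 2) (X 3) (X 4) (X 0) (-(X 3 + X 4)) := by
    have := map_dvd (Polynomial.evalRingHom (-(X 3 + X 4) : MvPolynomial (Fin 5) ℂ)) hr'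
    simpa [decicPoly, map_decic] using this
  obtain ⟨f, hf⟩ : ∃ f, f = finSuccEquiv ℂ 4 r := ⟨_, rfl⟩
  have X1 : finSuccEquiv ℂ 4 (X 1) = Polynomial.C (X 0) := finSuccEquiv_X_succ (j := 0)
  have X2 : finSuccEquiv ℂ 4 (X 2) = Polynomial.C (X 1) := finSuccEquiv_X_succ (j := 1)
  have X3 : finSuccEquiv ℂ 4 (X 3) = Polynomial.C (X 2) := finSuccEquiv_X_succ (j := 2)
  have X4 : finSuccEquiv ℂ 4 (X 4) = Polynomial.C (X 3) := finSuccEquiv_X_succ (j := 3)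
  have h1 : f ∣ decicLead (Polynomial.C (X 0)) (Polynomial.C (X 1)) (Polynomial.C (X 2))
      (Polynomial.C (X 3)) Polynomial.X := by
    have := map_dvd (finSuccEquiv ℂ 4 : _ →+* Polynomial (MvPolynomial (Fin 4) ℂ)) hr
    rw [map_decicLead] at this
    simpa only [RingHom.coe_coe, X1, X2, X3, X4, finSuccEquiv_X_zero, ← hf] using this
  have h2 : f ∣ decic (Polynomial.C (X 0)) (Polynomial.C (X 1)) (Polynomial.C (X 2))
      (Polynomial.C (X 3)) Polynomial.X (-(Polynomial.C (X 2) + Polynomial.C (X 3))) := by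
    have := map_dvd (finSuccEquiv ℂ 4 : _ →+* Polynomial (MvPolynomial (Fin 4) ℂ)) hv
    rw [map_decic] at this
    simpa only [RingHom.coe_coe, map_neg, map_add, X1, X2, X3, X4, finSuccEquiv_X_zero, ← hf]
      using this
  have hlead : IsUnit f.leadingCoeff := (monic_decicLead _ _ _ _).isUnit_leadingCoeff_of_dvd h1
  obtain ⟨e, he⟩ : ∃ e : MvPolynomial (Fin 4) ℂ →+* ℂ, e = eval ![1, 0, 2, 1] := ⟨_, rfl⟩
  have e0 : e (X 0) = 1 := by simp [he]
  have e1 : e (X 1) = 0 := by simp [he]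
  have e2 : e (X 2) = 2 := by simp [he]
  have e3 : e (X 3) = 1 := by simp [he]
  have h1' := map_dvd (Polynomial.mapRingHom e) h1
  have h2' := map_dvd (Polynomial.mapRingHom e) h2
  rw [map_decicLead] at h1'
  rw [map_decic] at h2'
  simp only [map_neg, map_add, Polynomial.coe_mapRingHom, Polynomial.map_C, Polynomial.map_X,
    e0, e1, e2, e3] at h1' h2'
  have h3 : decic (Polynomial.C 1) (Polynomial.C 0) (Polynomial.C 2) (Polynomial.C 1)
      (Polynomial.X : Polynomial ℂ) (-(Polynomial.C 2 + Polynomial.C 1)) = Polynomial.X ^ 2 := by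
    simp only [decic, map_one, map_zero, map_ofNat]
    ring
  rw [h3] at h2'
  have hcop : IsCoprime ((Polynomial.X : Polynomial ℂ) ^ 2)
      (decicLead (Polynomial.C 1) (Polynomial.C 0) (Polynomial.C 2) (Polynomial.C 1)
        Polynomial.X) := by
    apply IsCoprime.pow_left
    rw [Polynomial.irreducible_X.coprime_iff_not_dvd, Polynomial.X_dvd_iff,
      Polynomial.coeff_zero_eq_eval_zero, ← Polynomial.coe_evalRingHom, map_decicLead]
    simp only [Polynomial.coe_evalRingHom, Polynomial.eval_C, Polynomial.eval_X, decicLead]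
    norm_num
  have hunit : IsUnit (f.map e) := hcop.isUnit_of_dvd' h2' h1'
  have hdeg : f.natDegree = 0 := by
    rw [← Polynomial.natDegree_map_of_leadingCoeff_ne_zero e (hlead.map e).ne_zero]
    exact Polynomial.natDegree_eq_zero_of_isUnit hunit
  have hfu : IsUnit f := by
    rw [Polynomial.eq_C_of_natDegree_eq_zero hdeg]
    rw [Polynomial.leadingCoeff, hdeg] at hlead
    exact hlead.map Polynomial.C
  rw [hf] at hfu
  exact (MulEquiv.isUnit_map (finSuccEquiv ℂ 4)).1 hfu

theorem decicPoly_eq : decicPoly =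
    Polynomial.C (decicLead (X 1) (X 2) (X 3) (X 4) (X 0)) * Polynomial.X ^ 2
      + Polynomial.C (decicMid (X 1) (X 2) (X 3) (X 4) (X 0)) * Polynomial.X
      + Polynomial.C (decic (X 1) (X 2) (X 3) (X 4) (X 0) 0) := by
  rw [decicPoly, decic_eq_quadratic, map_decicLead, map_decicMid, map_decic, map_zero]

/-- A polynomial in `k, p, q, a, b` off whose zero set both roots `v` of the decic give points
of the image of `(U0, …, U5)`. -/
def badLocus {S : Type*} [CommRing S] (p q a b k : S) : S :=
  k * (p ^ 2 + q ^ 2) * ((p ^ 2 + q ^ 2 - a * b - k ^ 2) ^ 2 - 4 * k ^ 2 * (a * b))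
    * (a * b - k ^ 2) * decicLead p q a b k
    * (decicMid p q a b k ^ 2 - 4 * decicLead p q a b k * decic p q a b k 0)
    * decic p q a b k (-(a + b))
    * (decicLead p q a b k * (k * (a + b) + (p ^ 2 - q ^ 2)) ^ 2
      - decicMid p q a b k * k * (k * (a + b) + (p ^ 2 - q ^ 2)) + k ^ 2 * decic p q a b k 0)

theorem map_badLocus {S T : Type*} [CommRing S] [CommRing T] (f : S →+* T) (p q a b k : S) :
    f (badLocus p q a b k) = badLocus (f p) (f q) (f a) (f b) (f k) := by
  simp only [badLocus, map_add, map_sub, map_neg, map_mul, map_pow, map_ofNat, map_decic,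
    map_decicLead, map_decicMid, map_zero]

theorem badLocus_ne_zero :
    badLocus (X 1) (X 2) (X 3) (X 4) (X 0 : MvPolynomial (Fin 5) ℂ) ≠ 0 := by
  intro h
  have := congrArg (eval ![1, 1, 2, 1, 0]) h
  rw [map_badLocus] at this
  simp [badLocus, decic, decicLead, decicMid] at this
  norm_num at this

theorem exists_distinct_roots {α β γ : ℂ} (hα : α ≠ 0) (hd : β ^ 2 - 4 * α * γ ≠ 0) :
    ∃ v w : ℂ, v ≠ w ∧ α * v ^ 2 + β * v + γ = 0 ∧ α * w ^ 2 + β * w + γ = 0 := by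
  obtain ⟨d, hd'⟩ := IsAlgClosed.exists_pow_nat_eq (β ^ 2 - 4 * α * γ) (n := 2) (by norm_num)
  have hd0 : d ≠ 0 := by
    rintro rfl
    exact hd (by rw [← hd']; norm_num)
  refine ⟨(-β + d) / (2 * α), (-β - d) / (2 * α), ?_, ?_, ?_⟩
  · intro h
    field_simp at h
    exact hd0 (by linear_combination h / 2)
  · field_simp
    linear_combination hd'
  · field_simp
    linear_combination hd'

theorem exists_eval_U_eq_of_badLocus_ne_zero {p q a b k v : ℂ} (hbad : badLocus p q a b k ≠ 0)
    (hF : decic p q a b k v = 0) :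
    ∃ y : Fin 4 × Fin 2 → ℂ, eval y U0 = p ∧ eval y U1 = q ∧ eval y U2 = a ∧ eval y U3 = b ∧
      eval y U4 = k ∧ eval y U5 = p + k - v / 2 := by
  simp only [badLocus, mul_ne_zero_iff] at hbad
  obtain ⟨⟨⟨⟨⟨⟨⟨hk, hQ⟩, hS⟩, hN⟩, -⟩, -⟩, hT⟩, hE⟩ := hbad
  refine exists_eval_U_eq_s8 hF hk ?_ ?_ hQ hS hN
  · intro h
    rw [neg_eq_of_add_eq_zero_right h] at hT
    exact hT hF
  · intro h
    apply hE
    rw [decic_eq_quadratic] at hF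
    have hv : k * (a + b) + (p ^ 2 - q ^ 2) = -(k * v) := by linear_combination h
    rw [hv]
    linear_combination k ^ 2 * hF

/-- The coordinate change `u5 = p + k - v / 2`, as a map to polynomials in `v`. -/
def toPoly : MvPolynomial (Fin 6) ℂ →ₐ[ℂ] Polynomial (MvPolynomial (Fin 5) ℂ) :=
  aeval ![Polynomial.C (X 1), Polynomial.C (X 2), Polynomial.C (X 3), Polynomial.C (X 4),
    Polynomial.C (X 0),
    Polynomial.C (X 1) + Polynomial.C (X 0) - Polynomial.C (C (1 / 2)) * Polynomial.X]

/-- The inverse coordinate change `v = 2 * (u0 + u4 - u5)`. -/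
def ofPoly : Polynomial (MvPolynomial (Fin 5) ℂ) →+* MvPolynomial (Fin 6) ℂ :=
  Polynomial.eval₂RingHom (aeval ![X 4, X 0, X 1, X 2, X 3] : _ →ₐ[ℂ] _).toRingHom
    (2 * (X 0 + X 4 - X 5))

theorem ofPoly_toPoly (G : MvPolynomial (Fin 6) ℂ) : ofPoly (toPoly G) = G := by
  have h2 : C (2⁻¹ : ℂ) * (2 : MvPolynomial (Fin 6) ℂ) = 1 := by
    rw [← map_ofNat (C : ℂ →+* MvPolynomial (Fin 6) ℂ) 2, ← map_mul]; norm_num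
  have : ofPoly.comp (toPoly : _ →+* _) = RingHom.id (MvPolynomial (Fin 6) ℂ) := by
    apply MvPolynomial.ringHom_ext
    · intro c
      simp [ofPoly, toPoly, ← MvPolynomial.algebraMap_eq]
    · intro i
      fin_cases i
      · simp [ofPoly, toPoly]
      · simp [ofPoly, toPoly]
      · simp [ofPoly, toPoly]
      · simp [ofPoly, toPoly]
      · simp [ofPoly, toPoly]
      · simp [ofPoly, toPoly, MvPolynomial.algebraMap_eq]
        linear_combination (X 5 - X 0 - X 4) * h2
  exact congrArg (fun f : _ →+* _ => f G) this

theorem ofPoly_decicPoly :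
    ofPoly decicPoly = decic (X 0) (X 1) (X 2) (X 3) (X 4) (2 * (X 0 + X 4 - X 5)) := by
  rw [decicPoly, map_decic]
  simp [ofPoly]

theorem eval₂_toPoly_eq_zero {G : MvPolynomial (Fin 6) ℂ}
    (hG : aeval ![U0, U1, U2, U3, U4, U5] G = 0) {e : Fin 5 → ℂ} {v : ℂ}
    (hbad : badLocus (e 1) (e 2) (e 3) (e 4) (e 0) ≠ 0)
    (hF : decic (e 1) (e 2) (e 3) (e 4) (e 0) v = 0) :
    Polynomial.eval₂RingHom (eval e) v (toPoly G) = 0 := by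
  obtain ⟨y, h0, h1, h2, h3, h4, h5⟩ := exists_eval_U_eq_of_badLocus_ne_zero hbad hF
  have : (Polynomial.eval₂RingHom (eval e) v).comp (toPoly : _ →+* _) =
      (eval y).comp (aeval ![U0, U1, U2, U3, U4, U5] : _ →ₐ[ℂ] R).toRingHom := by
    apply MvPolynomial.ringHom_ext
    · intro c
      simp [toPoly]
    · intro i
      fin_cases i
      · simp [toPoly, h0]
      · simp [toPoly, h1]
      · simp [toPoly, h2]
      · simp [toPoly, h3]
      · simp [toPoly, h4]
      · simp [toPoly, h5]
        ring
  refine (congrArg (fun f : _ →+* _ => f G) this).trans ?_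
  change eval y (aeval ![U0, U1, U2, U3, U4, U5] G) = 0
  rw [hG, map_zero]

/-- Every relation among `U0, …, U5` is a multiple of the decic. -/
theorem decic_dvd {G : MvPolynomial (Fin 6) ℂ} (hG : aeval ![U0, U1, U2, U3, U4, U5] G = 0) :
    decic (X 0) (X 1) (X 2) (X 3) (X 4) (2 * (X 0 + X 4 - X 5)) ∣ G := by
  rw [← ofPoly_decicPoly, ← ofPoly_toPoly G]
  apply map_dvd
  obtain ⟨n, Q, r₁, r₀, h⟩ := exists_pow_mul_eq_quadratic_mul_add
    (decicLead (X 1) (X 2) (X 3) (X 4) (X 0)) (decicMid (X 1) (X 2) (X 3) (X 4) (X 0))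
    (decic (X 1) (X 2) (X 3) (X 4) (X 0) 0) (toPoly G)
  rw [← decicPoly_eq] at h
  have hr : ∀ e : Fin 5 → ℂ, badLocus (e 1) (e 2) (e 3) (e 4) (e 0) ≠ 0 →
      eval e r₁ = 0 ∧ eval e r₀ = 0 := by
    intro e hbad
    have hbad' := hbad
    simp only [badLocus, mul_ne_zero_iff] at hbad'
    obtain ⟨v, w, hvw, hv, hw⟩ := exists_distinct_roots hbad'.1.1.1.2 hbad'.1.1.2
    rw [← decic_eq_quadratic] at hv hw
    have key : ∀ z, decic (e 1) (e 2) (e 3) (e 4) (e 0) z = 0 →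
        eval e r₁ * z + eval e r₀ = 0 := by
      intro z hz
      have h' := congrArg (Polynomial.eval₂RingHom (eval e) z) h
      rw [map_mul, eval₂_toPoly_eq_zero hG hbad hz, map_add, map_mul, decicPoly, map_decic] at h'
      simpa [hz] using h'.symm
    have hv' := key v hv
    have hw' := key w hw
    have h1 : eval e r₁ = 0 := by
      apply (mul_eq_zero.1 (_ : eval e r₁ * (v - w) = 0)).resolve_right (sub_ne_zero.2 hvw)
      linear_combination hv' - hw'
    exact ⟨h1, by rw [h1] at hv'; linear_combination hv'⟩
  have hzero : ∀ r : MvPolynomial (Fin 5) ℂ,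
      (∀ e : Fin 5 → ℂ, badLocus (e 1) (e 2) (e 3) (e 4) (e 0) ≠ 0 → eval e r = 0) → r = 0 := by
    intro r hr
    apply (mul_eq_zero.1 (_ : badLocus (X 1) (X 2) (X 3) (X 4) (X 0) * r = 0)).resolve_left
      badLocus_ne_zero
    apply MvPolynomial.funext
    intro e
    rw [map_mul, map_badLocus, map_zero, mul_eq_zero]
    simp only [eval_X]
    by_cases he : badLocus (e 1) (e 2) (e 3) (e 4) (e 0) = 0
    · exact Or.inl he
    · exact Or.inr (hr e he)
  rw [hzero r₁ fun e he => (hr e he).1, hzero r₀ fun e he => (hr e he).2, map_zero, zero_mul,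
    add_zero, add_zero] at h
  have hlead : decicLead (X 1) (X 2) (X 3) (X 4) (X 0 : MvPolynomial (Fin 5) ℂ) ≠ 0 := by
    intro h0
    exact badLocus_ne_zero (by rw [badLocus, h0]; ring)
  have hrel : IsRelPrime decicPoly
      (Polynomial.C (decicLead (X 1) (X 2) (X 3) (X 4) (X 0)) ^ n) :=
    (isRelPrime_C_of_forall_dvd hlead fun r => isUnit_of_dvd_decicLead).symm.pow_right
  exact hrel.dvd_of_dvd_mul_left ⟨Q, h⟩

theorem isHomogeneous_decic {σ : Type*} {p q a b k v : MvPolynomial σ ℂ} (hp : p.IsHomogeneous 1)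
    (hq : q.IsHomogeneous 1) (ha : a.IsHomogeneous 1) (hb : b.IsHomogeneous 1)
    (hk : k.IsHomogeneous 1) (hv : v.IsHomogeneous 1) :
    (decic p q a b k v).IsHomogeneous 10 := by
  have h2 : (2 : MvPolynomial σ ℂ).IsHomogeneous 0 := isHomogeneous_C σ (2 : ℂ)
  have h4 : (4 : MvPolynomial σ ℂ).IsHomogeneous 0 := isHomogeneous_C σ (4 : ℂ)
  have hN := ha.mul hb
  have hσ := ha.add hb
  have hT := hσ.add hv
  have hQ := (hp.pow 2).add (hq.pow 2)
  have hm := (hQ.sub hN).sub (hk.pow 2)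
  have hK := (h2.mul ((hp.pow 2).mul (hq.pow 2))).sub
    ((hk.mul ((hp.pow 2).sub (hq.pow 2))).mul hT)
  have hW := (hσ.mul hv).add (h4.mul hN)
  have hM := ((hN.mul hm).add ((h4.mul (hk.pow 2)).mul hN)).add ((hk.pow 2).mul hm)
  exact (((((h4.mul hN).mul (hK.pow 2)).sub (((h2.mul hK).mul hW).mul hM)).add
    (((hk.pow 2).mul (hW.pow 2)).mul (hQ.pow 2))).add
    (((hT.pow 2).mul ((hm.pow 2).sub ((h4.mul (hk.pow 2)).mul hN))).mul
      ((hN.sub (hk.pow 2)).pow 2)))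

theorem exists_eq_smul_of_dvd {σ : Type*} {n : ℕ} {P G : MvPolynomial σ ℂ} (hP : P ≠ 0)
    (hPn : P.IsHomogeneous n) (hGn : G.IsHomogeneous n) (h : P ∣ G) : ∃ c : ℂ, G = c • P := by
  obtain ⟨H, rfl⟩ := h
  rcases eq_or_ne H 0 with rfl | hH
  · exact ⟨0, by simp⟩
  have hdeg := hGn.totalDegree (mul_ne_zero hP hH)
  rw [totalDegree_mul_of_isDomain hP hH, hPn.totalDegree hP] at hdeg
  rw [totalDegree_eq_zero_iff_eq_C.1 (by omega : H.totalDegree = 0)]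
  exact ⟨_, by rw [smul_eq_C_mul, mul_comm]⟩

/-- there is a nonzero homogeneous degree-10 relation among
`U0,…,U5`, unique up to scalar. -/
theorem stmt_8 :
    (∃ P : MvPolynomial (Fin 6) ℂ, P ≠ 0 ∧ P.IsHomogeneous 10 ∧
        aeval ![U0, U1, U2, U3, U4, U5] P = 0) ∧
    ∀ P1 P2 : MvPolynomial (Fin 6) ℂ,
      P1.IsHomogeneous 10 → P2.IsHomogeneous 10 →
      aeval ![U0, U1, U2, U3, U4, U5] P1 = 0 →
      aeval ![U0, U1, U2, U3, U4, U5] P2 = 0 →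
      P1 ≠ 0 → ∃ c : ℂ, P2 = c • P1 := by
  have hX := isHomogeneous_X (R := ℂ) (σ := Fin 6)
  have hhom := isHomogeneous_decic (hX 0) (hX 1) (hX 2) (hX 3) (hX 4)
    ((isHomogeneous_C _ (2 : ℂ)).mul (((hX 0).add (hX 4)).sub (hX 5)))
  have hne : decic (X 0) (X 1) (X 2) (X 3) (X 4)
      (2 * (X 0 + X 4 - X 5) : MvPolynomial (Fin 6) ℂ) ≠ 0 := by
    intro h
    have := congrArg (eval ![1, 2, 1, 0, 1, 2]) h
    rw [map_decic] at this
    simp [decic] at this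
    norm_num at this
  refine ⟨⟨_, hne, hhom, ?_⟩, ?_⟩
  · have := map_decic (aeval ![U0, U1, U2, U3, U4, U5] : _ →ₐ[ℂ] R).toRingHom
      (X 0) (X 1) (X 2) (X 3) (X 4) (2 * (X 0 + X 4 - X 5))
    refine this.trans ?_
    simp [map_ofNat, decic_U]
  · intro P1 P2 h1 h2 hU1 hU2 hP1
    obtain ⟨c₁, rfl⟩ := exists_eq_smul_of_dvd hne hhom h1 (decic_dvd hU1)
    obtain ⟨c₂, rfl⟩ := exists_eq_smul_of_dvd hne hhom h2 (decic_dvd hU2)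
    have hc₁ : c₁ ≠ 0 := by
      rintro rfl
      exact hP1 (zero_smul _ _)
    exact ⟨c₂ / c₁, by rw [smul_smul, div_mul_cancel₀ _ hc₁]⟩
end
end

section
/- The product F1·F2 is proportional to U5: there exists a nonzero scalar c ∈ ℂ such that F1·F2 = c·U5 in R. -/
open MvPolynomial

noncomputable section

/-- `F1·F2` is a nonzero scalar multiple of `U5`. -/
theorem stmt_9 : ∃ c : ℂ, c ≠ 0 ∧ F1 * F2 = c • U5 := by
  refine ⟨-2, by norm_num, ?_⟩
  have hI : (C Complex.I : R) ^ 2 = -1 := by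
    rw [← map_pow, Complex.I_sq, map_neg, map_one]
  have hhalf : 2 * (C (1 / 2 : ℂ) : R) = 1 := by
    rw [← map_ofNat (C : ℂ →+* R) 2, ← map_mul]
    norm_num
  have hneg : (C (-2 : ℂ) : R) = -2 := by
    rw [map_neg, map_ofNat]
  rw [smul_eq_C_mul, hneg]
  unfold F1 F2 U5 U0 U2 U3 U4
  linear_combination
    (-((x 1 0 * x 2 1 - x 1 1 * x 2 0) * (x 0 0 * x 3 0 + x 0 1 * x 3 1)) ^ 2) * hI +
    ((x 0 0 ^ 2 * x 1 0 ^ 2 + x 0 1 ^ 2 * x 1 1 ^ 2) *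
        (x 2 0 ^ 2 * x 3 0 ^ 2 + x 2 1 ^ 2 * x 3 1 ^ 2) +
      (x 0 1 ^ 2 * x 1 0 ^ 2 + x 0 0 ^ 2 * x 1 1 ^ 2) *
        (x 2 1 ^ 2 * x 3 0 ^ 2 + x 2 0 ^ 2 * x 3 1 ^ 2) -
      (x 0 0 ^ 2 + x 0 1 ^ 2) * (x 1 0 ^ 2 + x 1 1 ^ 2) * (x 2 0 ^ 2 + x 2 1 ^ 2) *
        (x 3 0 ^ 2 + x 3 1 ^ 2)) * hhalf
end
end

section
/- Let x = (x_{ij}) ∈ ℂ⁸ be a point with (x_{i0}, x_{i1}) ≠ (0,0) for each i = 1,2,3,4. Then U2(x) = 0 and U4(x) = 0 if and only if x lies in the union of the following 12 sets: {x_{10} = x_{21} = 0}; {x_{11} = x_{20} = 0}; {x_{30} = x_{41} = 0}; {x_{31} = x_{40} = 0}; {x_{1a} = 0 and x_{30}²x_{40}² + x_{31}²x_{41}² = 0} for a ∈ {0,1}; {x_{2a} = 0 and x_{30}²x_{40}² + x_{31}²x_{41}² = 0} for a ∈ {0,1}; {x_{3a} = 0 and x_{10}²x_{20}² + x_{11}²x_{21}²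 = 0} for a ∈ {0,1}; {x_{4a} = 0 and x_{10}²x_{20}² + x_{11}²x_{21}² = 0} for a ∈ {0,1}. (These are the 12 two-dimensional irreducible components of {U2 = U4 = 0} ⊂ (ℙ¹)⁴.) -/
open MvPolynomial

noncomputable section

/-- If `[a : b]` and `[c : d]` are points of the projective line, `abcd = 0` and
`a²c² + b²d² = 0`, then `a = d = 0` or `b = c = 0`. -/
theorem eq_zero_pair_of_sq_add_sq_eq_zero {K : Type*} [Field K] {a b c d : K}
    (hab : ¬(a = 0 ∧ b = 0)) (hcd : ¬(c = 0 ∧ d = 0))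
    (h : a ^ 2 * c ^ 2 + b ^ 2 * d ^ 2 = 0) (h' : a * b * c * d = 0) :
    (a = 0 ∧ d = 0) ∨ (b = 0 ∧ c = 0) := by
  simp only [mul_eq_zero] at h'
  rcases h' with ((rfl | rfl) | rfl) | rfl <;> simp_all

/-- description of the zero locus of `{U2 = U4 = 0}` (away from the points
with some `(x_{i0}, x_{i1}) = (0,0)`) as a union of 12 sets. -/
theorem stmt_17 :
    ∀ v : Fin 4 × Fin 2 → ℂ,
      (∀ i : Fin 4, (v (i, 0), v (i, 1)) ≠ (0, 0)) →
      ((eval v U2 = 0 ∧ eval v U4 = 0) ↔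
        ((v (0, 0) = 0 ∧ v (1, 1) = 0) ∨
         (v (0, 1) = 0 ∧ v (1, 0) = 0) ∨
         (v (2, 0) = 0 ∧ v (3, 1) = 0) ∨
         (v (2, 1) = 0 ∧ v (3, 0) = 0) ∨
         (∃ a : Fin 2, v (0, a) = 0 ∧
            v (2, 0) ^ 2 * v (3, 0) ^ 2 + v (2, 1) ^ 2 * v (3, 1) ^ 2 = 0) ∨
         (∃ a : Fin 2, v (1, a) = 0 ∧
            v (2, 0) ^ 2 * v (3, 0) ^ 2 + v (2, 1) ^ 2 * v (3, 1) ^ 2 = 0) ∨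
         (∃ a : Fin 2, v (2, a) = 0 ∧
            v (0, 0) ^ 2 * v (1, 0) ^ 2 + v (0, 1) ^ 2 * v (1, 1) ^ 2 = 0) ∨
         (∃ a : Fin 2, v (3, a) = 0 ∧
            v (0, 0) ^ 2 * v (1, 0) ^ 2 + v (0, 1) ^ 2 * v (1, 1) ^ 2 = 0))) := by
  intro v hv
  simp only [ne_eq, Prod.mk.injEq] at hv
  have h2 : eval v U2 = (v (0, 0) ^ 2 * v (1, 0) ^ 2 + v (0, 1) ^ 2 * v (1, 1) ^ 2) *
      (v (2, 0) ^ 2 * v (3, 0) ^ 2 + v (2, 1) ^ 2 * v (3, 1) ^ 2) := by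
    simp [U2, x]
  have h4 : eval v U4 = 4 * ((v (0, 0) * v (0, 1) * v (1, 0) * v (1, 1)) *
      (v (2, 0) * v (2, 1) * v (3, 0) * v (3, 1))) := by
    simp [U4, x]
    ring
  rw [h2, h4]
  constructor
  · rintro ⟨hU2, hU4⟩
    have hU4' := (mul_eq_zero.mp hU4).resolve_left (by norm_num)
    simp only [Fin.exists_fin_two]
    rcases mul_eq_zero.mp hU2 with h | h <;> rcases mul_eq_zero.mp hU4' with h' | h'
    · rcases eq_zero_pair_of_sq_add_sq_eq_zero (hv 0) (hv 1) h h' with ⟨h₁, h₂⟩ | ⟨h₁, h₂⟩ <;>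
        simp [h₁, h₂]
    · simp only [mul_eq_zero] at h'
      rcases h' with ((h' | h') | h') | h' <;> simp [h, h']
    · simp only [mul_eq_zero] at h'
      rcases h' with ((h' | h') | h') | h' <;> simp [h, h']
    · rcases eq_zero_pair_of_sq_add_sq_eq_zero (hv 2) (hv 3) h h' with ⟨h₁, h₂⟩ | ⟨h₁, h₂⟩ <;>
        simp [h₁, h₂]
  · simp only [Fin.exists_fin_two]
    rintro (⟨h, h'⟩ | ⟨h, h'⟩ | ⟨h, h'⟩ | ⟨h, h'⟩ | (⟨h, h'⟩ | ⟨h, h'⟩) | (⟨h, h'⟩ | ⟨h, h'⟩) |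
      (⟨h, h'⟩ | ⟨h, h'⟩) | (⟨h, h'⟩ | ⟨h, h'⟩)) <;> simp [h, h']
end
end

section
/- Let P ⊂ (ℂ²)⁴ be the following set of 64 points x = ((x_{10},x_{11}), (x_{20},x_{21}), (x_{30},x_{31}), (x_{40},x_{41})), given as the union of four families of 16 points each: (I) (x_{10},x_{11}), (x_{20},x_{21}) ∈ {(0,1),(1,0)}, (x_{30},x_{31}) ∈ {(1,1),(1,−1)}, (x_{40},x_{41}) ∈ {(1,i),(1,−i)}; (II) (x_{10},x_{11}), (x_{20},x_{21}) ∈ {(0,1),(1,0)}, (x_{30},x_{31}) ∈ {(1,i),(1,−i)}, (x_{40},x_{41}) ∈ {(1,1),(1,−1)}; (III) (x_{10},x_{11}) ∈ {(1,1),(1,−1)}, (x_{20},x_{21}) ∈ {(1,i),(1,−i)}, (x_{30},x_{31}), (x_{40},x_{41}) ∈ {(0,1),(1,0)}; (IV) (x_{10},x_{11}) ∈ {(1,i),(1,−i)}, (x_{20},x_{21}) ∈ {(1,1),(1,−1)}, (x_{30},x_{31}), (x_{40},x_{41}) ∈ {(0,1),(1,0)}. Then P has exactly 64 elements, and F1 vanishes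 at exactly 32 of them. (These 64 points are the base points of the linear system L spanned by U0,…,U5 on (ℙ¹)⁴, and exactly 32 of them — two G-orbits of 16 — lie on the threefold V = {F1 = 0}, giving the two base points of the twisted bicanonical system |2K_S + η|.) -/
open MvPolynomial

noncomputable section

/-- The coordinate pair `(x_{i0}, x_{i1})` of a point of `ℂ⁸`. -/
def pair (v : Fin 4 × Fin 2 → ℂ) (i : Fin 4) : ℂ × ℂ := (v (i, 0), v (i, 1))

def S01 : Set (ℂ × ℂ) := {(0, 1), (1, 0)}
def SPM : Set (ℂ × ℂ) := {(1, 1), (1, -1)}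
def SPI : Set (ℂ × ℂ) := {(1, Complex.I), (1, -Complex.I)}

/-- The 64 base points of the linear system `L`, as points of `(ℂ²)⁴ = ℂ⁸`. -/
def P : Set (Fin 4 × Fin 2 → ℂ) :=
  {v | (pair v 0 ∈ S01 ∧ pair v 1 ∈ S01 ∧ pair v 2 ∈ SPM ∧ pair v 3 ∈ SPI) ∨
       (pair v 0 ∈ S01 ∧ pair v 1 ∈ S01 ∧ pair v 2 ∈ SPI ∧ pair v 3 ∈ SPM) ∨
       (pair v 0 ∈ SPM ∧ pair v 1 ∈ SPI ∧ pair v 2 ∈ S01 ∧ pair v 3 ∈ S01) ∨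
       (pair v 0 ∈ SPI ∧ pair v 1 ∈ SPM ∧ pair v 2 ∈ S01 ∧ pair v 3 ∈ S01)}

/-- The coordinate pairs over the Gaussian integers; the first index selects `S01`, `SPM` or `SPI`,
the second one of its two elements. -/
def gaussianPair : Fin 3 → Fin 2 → Fin 2 → GaussianInt :=
  ![![![0, 1], ![1, 0]], ![![1, 1], ![1, -1]], ![![1, ⟨0, 1⟩], ![1, ⟨0, -1⟩]]]

/-- `family k i` selects the set containing the `i`-th coordinate pair in the `k`-th family. -/
def family : Fin 4 → Fin 4 → Fin 3 :=
  ![![0, 0, 1, 2], ![0, 0, 2, 1], ![1, 2, 0, 0], ![2, 1, 0, 0]]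

/-- The points of `P`, with coordinates in the Gaussian integers. -/
def gaussianPoint (t : Fin 4 × (Fin 4 → Fin 2)) (p : Fin 4 × Fin 2) : GaussianInt :=
  gaussianPair (family t.1 p.1) (t.2 p.1) p.2

/-- The points of `P`, indexed by the family and the choice of each coordinate pair. -/
def basePoint (t : Fin 4 × (Fin 4 → Fin 2)) (p : Fin 4 × Fin 2) : ℂ :=
  GaussianInt.toComplex (gaussianPoint t p)

/-- The value of `F1` at a point with Gaussian integer coordinates. -/
def gaussianF1 (v : Fin 4 × Fin 2 → GaussianInt) : GaussianInt :=
  (v (1, 0) * v (2, 0) - v (1, 1) * v (2, 1)) * (v (0, 1) * v (3, 0) + v (0, 0) * v (3, 1)) -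
    ⟨0, 1⟩ * ((v (1, 0) * v (2, 1) - v (1, 1) * v (2, 0)) *
      (v (0, 0) * v (3, 0) + v (0, 1) * v (3, 1)))

lemma gaussianPair_injective {a b : Fin 3} {s t : Fin 2}
    (h : ∀ j, gaussianPair a s j = gaussianPair b t j) : a = b ∧ s = t := by
  revert a b s t
  decide

lemma family_injective : Function.Injective family := by
  decide

lemma basePoint_injective : Function.Injective basePoint := by
  rintro ⟨k, s⟩ ⟨l, t⟩ h
  have key (i : Fin 4) : family k i = family l i ∧ s i = t i :=
    gaussianPair_injective fun j => GaussianInt.toComplex_injective (congrFun h (i, j))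
  exact Prod.ext (family_injective (funext fun i => (key i).1)) (funext fun i => (key i).2)

lemma toComplex_I : GaussianInt.toComplex ⟨0, 1⟩ = Complex.I := by
  simp [GaussianInt.toComplex_def']

lemma eval_F1_basePoint (t : Fin 4 × (Fin 4 → Fin 2)) :
    eval (basePoint t) F1 = GaussianInt.toComplex (gaussianF1 (gaussianPoint t)) := by
  simp only [F1, x, gaussianF1, basePoint, map_sub, map_mul, map_add, eval_X, eval_C, toComplex_I]

/-- The three sets of coordinate pairs, in the order used by `gaussianPair`. -/
def pairSet : Fin 3 → Set (ℂ × ℂ) := ![S01, SPM, SPI]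

lemma mem_pairSet_iff (a : Fin 3) (z : ℂ × ℂ) :
    z ∈ pairSet a ↔ ∃ s, GaussianInt.toComplex (gaussianPair a s 0) = z.1 ∧
      GaussianInt.toComplex (gaussianPair a s 1) = z.2 := by
  obtain ⟨z, w⟩ := z
  fin_cases a <;>
    simp [pairSet, gaussianPair, S01, SPM, SPI, GaussianInt.toComplex_def', Fin.exists_fin_two,
      eq_comm]

lemma mem_P_iff (v : Fin 4 × Fin 2 → ℂ) :
    v ∈ P ↔ ∃ k, ∀ i, pair v i ∈ pairSet (family k i) := by
  simp [P, pairSet, family, Fin.exists_fin_succ, Fin.forall_fin_succ]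

lemma range_basePoint : Set.range basePoint = P := by
  ext v
  simp only [mem_P_iff, mem_pairSet_iff, Set.mem_range, Prod.exists, Classical.skolem]
  refine exists_congr fun k => exists_congr fun s => ?_
  simp [funext_iff, Prod.forall, Fin.forall_fin_two, basePoint, gaussianPoint, pair]

lemma card_gaussianF1_eq_zero :
    (Finset.univ.filter fun t => gaussianF1 (gaussianPoint t) = 0).card = 32 := by
  decide +kernel

/-- `P` has exactly 64 elements and `F1` vanishes at exactly 32 of them. -/
theorem stmt_19 :
    P.ncard = 64 ∧ {v ∈ P | eval v F1 = 0}.ncard = 32 := by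
  refine ⟨?_, ?_⟩
  · rw [← range_basePoint, ← Set.image_univ, Set.ncard_image_of_injective _ basePoint_injective,
      Set.ncard_univ]
    simp
  · have h : {v ∈ P | eval v F1 = 0} =
        basePoint '' (Finset.univ.filter fun t => gaussianF1 (gaussianPoint t) = 0 : Finset _) := by
      ext v
      simp only [← range_basePoint, Set.mem_ofPred_eq, Set.mem_range, Set.mem_image,
        Finset.coe_filter, Finset.mem_univ, true_and]
      constructor
      · rintro ⟨⟨t, rfl⟩, ht⟩
        rw [eval_F1_basePoint, GaussianInt.toComplex_eq_zero] at ht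
        exact ⟨t, ht, rfl⟩
      · rintro ⟨t, ht, rfl⟩
        exact ⟨⟨t, rfl⟩, by rw [eval_F1_basePoint, ht, map_zero]⟩
    rw [h, Set.ncard_image_of_injective _ basePoint_injective, Set.ncard_coe_finset,
      card_gaussianF1_eq_zero]
end
end
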